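/- Let d ≥ 1 and α ∈ (−1,∞)^d. Define the maximal operator K_*^α f(x) = sup_{0<s<1} ∫_{(0,∞)^d} K_s^α(x,y) f(y) dν_α(y) for measurable f ≥ 0. Then there is a constant C (depending only on d and α) such that ν_α{x ∈ (0,∞)^d : K_*^α f(x) > λ} ≤ (C/λ) ∫_{(0,∞)^d} f(x) dν_α(x) for every λ > 0 and every 0 ≤ f ∈ L¹(dν_α). -/

import Mathlib

open MeasureTheory

/-- The measure `ν_α` on `(0,∞)^d` with density `(∏ x_i^{2α_i+1}) e^{−|x|²}`
with respect to Lebesgue measure. -/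
noncomputable def nu (d : ℕ) (α : Fin d → ℝ) : Measure (Fin d → ℝ) :=
  ((volume : Measure (Fin d → ℝ)).withDensity fun x =>
    ENNReal.ofReal ((∏ i, x i ^ (2 * α i + 1)) * Real.exp (-∑ i, x i ^ 2))).restrict
    {x | ∀ i, 0 < x i}

/-- The kernel
`K_s^α(x,y) = s^{−d/2} (∏ (x_i + √s)^{−2α_i−1}) exp(|x|² − |(1+s)x − (1−s)y|²/(8s))`. -/
noncomputable def Kker (d : ℕ) (α : Fin d → ℝ) (s : ℝ) (x y : Fin d → ℝ) : ℝ :=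
  s ^ (-(d : ℝ) / 2) * (∏ i, (x i + Real.sqrt s) ^ (-(2 * α i + 1))) *
    Real.exp ((∑ i, x i ^ 2) - (∑ i, ((1 + s) * x i - (1 - s) * y i) ^ 2) / (8 * s))


lemma slice_le (n : ℕ) (i0 : Fin (n+1)) (g : Fin (n+1) → ℝ → ENNReal)
    (hg : ∀ i, Measurable (g i)) (S : Set (Fin (n+1) → ℝ)) (hS : MeasurableSet S) (D : ENNReal)
    (hD : ∀ w : Fin n → ℝ, ∫⁻ t, g i0 t * S.indicator 1 (i0.insertNth t w) ≤ D) :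
    ∫⁻ z, (∏ i, g i (z i)) * S.indicator 1 z ≤
      D * ∫⁻ w : Fin n → ℝ, ∏ j, g (i0.succAbove j) (w j) := by
  have hmp := (volume_preserving_piFinSuccAbove (fun _ : Fin (n+1) => ℝ) i0).symm
  rw [← hmp.lintegral_comp_emb (MeasurableEquiv.measurableEmbedding _)]
  have hm : Measurable fun z : Fin (n+1) → ℝ => (∏ i, g i (z i)) * S.indicator 1 z := by
    apply Measurable.mul
    · exact Finset.measurable_prod _ fun i _ => (hg i).comp (measurable_pi_apply i)
    · exact measurable_one.indicator hS
  rw [Measure.volume_eq_prod, lintegral_prod_symm]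
  · rw [← lintegral_const_mul]
    · apply lintegral_mono
      intro w
      simp only
      have : ∀ t : ℝ, (∏ i, g i ((MeasurableEquiv.piFinSuccAbove (fun _ : Fin (n+1) => ℝ) i0).symm (t, w) i)) *
          S.indicator 1 ((MeasurableEquiv.piFinSuccAbove (fun _ : Fin (n+1) => ℝ) i0).symm (t, w))
          = (g i0 t * S.indicator 1 (i0.insertNth t w)) * ∏ j, g (i0.succAbove j) (w j) := by
        intro t
        rw [Fin.prod_univ_succAbove _ i0]
        simp [MeasurableEquiv.piFinSuccAbove, Fin.insertNthEquiv]
        ring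
      simp_rw [this]
      rw [lintegral_mul_const]
      · gcongr
        exact hD w
      · apply (hg i0).mul
        apply (measurable_one.indicator hS).comp
        have := (MeasurableEquiv.piFinSuccAbove (fun _ : Fin (n+1) => ℝ) i0).symm.measurable
        have h2 := this.comp (measurable_id.prodMk (measurable_const (a := w)))
        simpa [MeasurableEquiv.piFinSuccAbove, Fin.insertNthEquiv, Function.comp_def] using h2
    · exact Finset.measurable_prod _ fun i _ => (hg _).comp (measurable_pi_apply i)
  · exact (hm.comp (MeasurableEquiv.measurable _)).aemeasurable

lemma prod_le (n : ℕ) (g : Fin n → ℝ → ENNReal) (hg : ∀ i, Measurable (g i)) :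
    ∫⁻ z : Fin n → ℝ, ∏ i, g i (z i) ≤ ∏ i, ∫⁻ t, g i t := by
  induction n with
  | zero => simp [volume_pi, Measure.pi_of_empty]
  | succ n ih =>
    have h := slice_le n 0 g hg Set.univ MeasurableSet.univ (∫⁻ t, g 0 t) (by intro w; simp)
    simp only [Set.indicator_univ, Pi.one_apply, mul_one] at h
    refine h.trans ?_
    rw [Fin.prod_univ_succ]
    gcongr
    simpa using ih (fun j => g j.succ) (fun j => hg _)

lemma cover_le {X : Type*} [MeasurableSpace X] (ν : Measure X) (I : Set (X × ℝ))
    (B : X × ℝ → Set X) (hB : ∀ p ∈ I, MeasurableSet (B p)) (δ : X × ℝ → ℝ) (R τ : ℝ) (hτ : 1 < τ)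
    (h0 : ∀ p ∈ I, 0 ≤ δ p) (hR : ∀ p ∈ I, δ p ≤ R) (f : X → ENNReal)
    (hf : ∫⁻ x, f x ∂ν ≠ ⊤) (D : ENNReal)
    (hpos : ∀ p ∈ I, ∫⁻ x in B p, f x ∂ν ≠ 0)
    (h : ∀ p ∈ I, ν {z | ∃ q ∈ I, q.1 = z ∧ (B q ∩ B p).Nonempty ∧ δ q ≤ τ * δ p} ≤
      D * ∫⁻ x in B p, f x ∂ν) :
    ν (Prod.fst '' I) ≤ D * ∫⁻ x, f x ∂ν := by
  obtain ⟨u, huI, hdis, hcov⟩ := Vitali.exists_disjoint_subfamily_covering_enlargement B I δ τ hτ h0 R hR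
    (by
      intro a ha
      by_contra hne
      rw [Set.not_nonempty_iff_eq_empty] at hne
      apply hpos a ha
      simp [hne])
  have hcount : u.Countable := by
    have : IsFiniteMeasure (ν.withDensity f) := isFiniteMeasure_withDensity hf
    have hh := Measure.countable_meas_pos_of_disjoint_iUnion (μ := ν.withDensity f)
      (As := fun p : u => B p) (fun p => hB _ (huI p.2))
      (fun a b hab => hdis a.2 b.2 (fun h => hab (Subtype.ext h)))
    have h2 : {i : u | 0 < (ν.withDensity f) (B i)} = Set.univ := by
      ext p
      simp only [Set.mem_ofPred_eq, Set.mem_univ, iff_true]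
      rw [withDensity_apply _ (hB _ (huI p.2))]
      exact pos_iff_ne_zero.2 (hpos _ (huI p.2))
    rw [h2] at hh
    exact Set.countable_coe_iff.1 (Set.countable_univ_iff.1 hh)
  have hsub : Prod.fst '' I ⊆ ⋃ p ∈ u, {z | ∃ q ∈ I, q.1 = z ∧ (B q ∩ B p).Nonempty ∧ δ q ≤ τ * δ p} := by
    rintro z ⟨q, hq, rfl⟩
    obtain ⟨b, hb, h1, h2⟩ := hcov q hq
    simp only [Set.mem_iUnion]
    exact ⟨b, hb, q, hq, rfl, h1, h2⟩
  calc ν (Prod.fst '' I) ≤ ν (⋃ p ∈ u, {z | ∃ q ∈ I, q.1 = z ∧ (B q ∩ B p).Nonempty ∧ δ q ≤ τ * δ p}) :=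
        measure_mono hsub
    _ ≤ ∑' p : u, ν {z | ∃ q ∈ I, q.1 = z ∧ (B q ∩ B p).Nonempty ∧ δ q ≤ τ * δ p} :=
        measure_biUnion_le _ hcount _
    _ ≤ ∑' p : u, D * ∫⁻ x in B p, f x ∂ν := ENNReal.tsum_le_tsum fun p => h _ (huI p.2)
    _ = D * ∫⁻ x in ⋃ p ∈ u, B p, f x ∂ν := by
        rw [ENNReal.tsum_mul_left, lintegral_biUnion hcount (fun p hp => hB _ (huI hp)) hdis]
    _ ≤ D * ∫⁻ x, f x ∂ν := by
        gcongr
        exact Measure.restrict_le_self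

lemma rpow_comp (β a b M : ℝ) (hM : 1 ≤ M) (ha : 0 < a) (hb : 0 < b) (h1 : a ≤ M * b) (h2 : b ≤ M * a) :
    a ^ β ≤ M ^ |β| * b ^ β := by
  have hM0 : 0 < M := by linarith
  rcases le_total 0 β with hβ | hβ
  · rw [abs_of_nonneg hβ, ← Real.mul_rpow hM0.le hb.le]
    exact Real.rpow_le_rpow ha.le h1 hβ
  · rw [abs_of_nonpos hβ, Real.rpow_neg hM0.le, ← Real.inv_rpow hM0.le, ← Real.mul_rpow (by positivity) hb.le]
    apply Real.rpow_le_rpow_of_nonpos (by positivity) _ hβ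
    rw [inv_mul_le_iff₀ hM0]; exact h2

/-- the basic one-dimensional estimate -/
lemma one_dim (β : ℝ) (hβ : -1 < β) : ∃ K0 : ℕ, ∀ K : ℕ, K0 ≤ K → ∀ L c r : ℝ, 1 ≤ L → 0 ≤ c → 0 < r →
    ∫⁻ t, ({t : ℝ | 0 < t ∧ |t - c| ≤ L * r}.indicator (fun t => ENNReal.ofReal (t ^ β)) t) ≤
      ENNReal.ofReal (K * L ^ K * (r * (c + r) ^ β)) := by
  obtain ⟨K0, hK0⟩ := exists_nat_ge (max (max (2 * 4 ^ |β|) (3 * (3:ℝ) ^ |β| / (β + 1))) (|β| + 1))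
  refine ⟨K0, fun K hK L c r hL hc hr => ?_⟩
  have hKr : (K0 : ℝ) ≤ K := by exact_mod_cast hK
  have hA : 2 * 4 ^ |β| ≤ (K : ℝ) := (le_max_left _ _).trans ((le_max_left _ _).trans (hK0.trans hKr))
  have hA' : 3 * (3:ℝ) ^ |β| / (β + 1) ≤ (K : ℝ) := (le_max_right _ _).trans ((le_max_left _ _).trans (hK0.trans hKr))
  have hA2 : |β| + 1 ≤ (K : ℝ) := (le_max_right _ _).trans (hK0.trans hKr)
  have hL0 : 0 < L := by linarith
  have hLK : L ^ (|β| + 1) ≤ L ^ K := by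
    rw [← Real.rpow_natCast]
    exact Real.rpow_le_rpow_of_exponent_le hL hA2
  have hLr : r ≤ L * r := by nlinarith
  have hms : MeasurableSet {t : ℝ | 0 < t ∧ |t - c| ≤ L * r} := by measurability
  rw [lintegral_indicator hms]
  by_cases hcase : 2 * (L * r) ≤ c
  · -- far from the origin
    have hb : ∀ t ∈ {t : ℝ | 0 < t ∧ |t - c| ≤ L * r}, ENNReal.ofReal (t ^ β) ≤ ENNReal.ofReal (4 ^ |β| * (c + r) ^ β) := by
      rintro t ⟨ht, htc⟩
      rw [abs_le] at htc
      apply ENNReal.ofReal_le_ofReal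
      apply rpow_comp _ _ _ _ (by norm_num) ht (by linarith) <;> linarith
    calc _ ≤ ∫⁻ t in {t : ℝ | 0 < t ∧ |t - c| ≤ L * r}, ENNReal.ofReal (4 ^ |β| * (c + r) ^ β) :=
          setLIntegral_mono' hms hb
      _ = ENNReal.ofReal (4 ^ |β| * (c + r) ^ β) * volume {t : ℝ | 0 < t ∧ |t - c| ≤ L * r} := by simp
      _ ≤ ENNReal.ofReal (4 ^ |β| * (c + r) ^ β) * volume (Set.Icc (c - L * r) (c + L * r)) := by
          gcongr
          rintro t ⟨ht, htc⟩
          rw [abs_le] at htc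
          constructor <;> linarith
      _ = ENNReal.ofReal (4 ^ |β| * (c + r) ^ β * (2 * (L * r))) := by
          rw [Real.volume_Icc, ← ENNReal.ofReal_mul (by positivity)]
          congr 2; ring
      _ ≤ _ := by
          apply ENNReal.ofReal_le_ofReal
          have e1 : L ≤ L ^ K := by
            refine le_trans ?_ hLK
            conv_lhs => rw [← Real.rpow_one L]
            apply Real.rpow_le_rpow_of_exponent_le hL; linarith [abs_nonneg β]
          calc 4 ^ |β| * (c + r) ^ β * (2 * (L * r)) = (2 * 4 ^ |β|) * L * (r * (c+r)^β) := by ring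
            _ ≤ K * L ^ K * (r * (c + r) ^ β) := by gcongr
  · push Not at hcase
    have hsub : {t : ℝ | 0 < t ∧ |t - c| ≤ L * r} ⊆ Set.Ioc 0 (3 * (L * r)) := by
      rintro t ⟨ht, htc⟩
      rw [abs_le] at htc
      constructor <;> linarith
    calc _ ≤ ∫⁻ t in Set.Ioc 0 (3 * (L * r)), ENNReal.ofReal (t ^ β) := lintegral_mono_set hsub
      _ = ENNReal.ofReal (∫ t in Set.Ioc 0 (3 * (L * r)), t ^ β) := by
          rw [ofReal_integral_eq_lintegral_ofReal]
          · have := intervalIntegral.intervalIntegrable_rpow' (a := 0) (b := 3 * (L * r)) hβ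
            exact (intervalIntegrable_iff_integrableOn_Ioc_of_le (by positivity)).1 this
          · filter_upwards [ae_restrict_mem measurableSet_Ioc] with t ht
            exact Real.rpow_nonneg ht.1.le _
      _ = ENNReal.ofReal ((3 * (L * r)) ^ (β + 1) / (β + 1)) := by
          rw [← intervalIntegral.integral_of_le (by positivity), integral_rpow (Or.inl hβ),
            Real.zero_rpow (by linarith)]
          simp
      _ ≤ _ := by
          apply ENNReal.ofReal_le_ofReal
          have e1 : (3 * (L * r)) ^ β ≤ (3 * L) ^ |β| * (c + r) ^ β := by
            apply rpow_comp _ _ _ _ (by linarith) (by positivity) (by positivity)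
            · nlinarith
            · nlinarith
          have hb1 : 0 < β + 1 := by linarith
          rw [Real.rpow_add_one (by positivity)]
          calc (3 * (L * r)) ^ β * (3 * (L * r)) / (β + 1) ≤ ((3 * L) ^ |β| * (c + r) ^ β) * (3 * (L * r)) / (β + 1) := by gcongr
            _ = (3 * (3:ℝ) ^ |β| / (β + 1)) * L ^ (|β| + 1) * (r * (c+r)^β) := by
                rw [Real.mul_rpow (by norm_num) hL0.le, Real.rpow_add_one hL0.ne']; ring
            _ ≤ K * L ^ K * (r * (c + r) ^ β) := by gcongr

/-- the one-dimensional slice estimate -/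
lemma one_slice (β X a : ℝ) (hX : 0 < X) (T : Set ℝ) (hT : MeasurableSet T)
    (h1 : ∀ t ∈ T, X / 2 ≤ t ∧ t ≤ 2 * X ∧ a ≤ t ^ 2 ∧ t ^ 2 ≤ a + 1) :
    ∫⁻ t, T.indicator (fun t => ENNReal.ofReal (t ^ β)) t ≤ ENNReal.ofReal (2 ^ |β| * X ^ β * (1 / X)) := by
  rw [lintegral_indicator hT]
  calc _ ≤ ∫⁻ t in T, ENNReal.ofReal (2 ^ |β| * X ^ β) := by
        apply setLIntegral_mono' hT
        intro t ht
        obtain ⟨a1, a2, -⟩ := h1 t ht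
        apply ENNReal.ofReal_le_ofReal
        apply rpow_comp _ _ _ _ (by norm_num) (by linarith) hX <;> linarith
    _ = ENNReal.ofReal (2 ^ |β| * X ^ β) * volume T := by simp
    _ ≤ ENNReal.ofReal (2 ^ |β| * X ^ β) * ENNReal.ofReal (1 / X) := by
        gcongr
        refine (Real.volume_le_diam T).trans ?_
        apply Metric.ediam_le
        intro t ht u hu
        obtain ⟨a1, a2, a3, a4⟩ := h1 t ht
        obtain ⟨b1, b2, b3, b4⟩ := h1 u hu
        rw [edist_dist]
        apply ENNReal.ofReal_le_ofReal
        rw [Real.dist_eq, le_div_iff₀ hX]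
        rcases abs_cases (t - u) with ⟨e, h⟩ | ⟨e, h⟩ <;> rw [e] <;> nlinarith
    _ = _ := by rw [← ENNReal.ofReal_mul (by positivity)]

/-- uniform form of the one-dimensional estimate -/
def OD (β : ℝ) (K : ℕ) : Prop := ∀ L c r : ℝ, 1 ≤ L → 0 ≤ c → 0 < r →
    ∫⁻ t, ({t : ℝ | 0 < t ∧ |t - c| ≤ L * r}.indicator (fun t => ENNReal.ofReal (t ^ β)) t) ≤
      ENNReal.ofReal (K * L ^ K * (r * (c + r) ^ β))

lemma exists_OD (d : ℕ) (β : Fin d → ℝ) (hβ : ∀ i, -1 < β i) : ∃ K : ℕ, 1 ≤ K ∧ ∀ i, OD (β i) K := by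
  choose K0 hK0 using fun i => one_dim (β i) (hβ i)
  refine ⟨1 + ∑ i, K0 i, by omega, fun i => hK0 i _ ?_⟩
  have := Finset.single_le_sum (f := K0) (fun j _ => Nat.zero_le _) (Finset.mem_univ i)
  omega

/-- one-dimensional weight -/
noncomputable def wt (β t : ℝ) : ENNReal := (Set.Ioi 0).indicator (fun t => ENNReal.ofReal (t ^ β)) t

lemma nu_le (d : ℕ) (α : Fin d → ℝ) (S T : Set (Fin d → ℝ)) (hT : MeasurableSet T) (e : ℝ)
    (hST : ∀ z ∈ S, (∀ i, 0 < z i) → z ∈ T) (he : ∀ z ∈ T, -∑ i, z i ^ 2 ≤ e) :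
    nu d α S ≤ ENNReal.ofReal (Real.exp e) *
      ∫⁻ z, (∏ i, wt (2 * α i + 1) (z i)) * T.indicator 1 z := by
  have hO : MeasurableSet {x : Fin d → ℝ | ∀ i, 0 < x i} := by
    have : {x : Fin d → ℝ | ∀ i, 0 < x i} = ⋂ i, {x | 0 < x i} := by ext; simp
    rw [this]
    exact MeasurableSet.iInter fun i => measurableSet_lt measurable_const (measurable_pi_apply i)
  unfold nu
  rw [Measure.restrict_apply' hO]
  calc _ ≤ (volume.withDensity fun x : Fin d → ℝ =>
      ENNReal.ofReal ((∏ i, x i ^ (2 * α i + 1)) * Real.exp (-∑ i, x i ^ 2))) (T ∩ {x | ∀ i, 0 < x i}) := by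
        apply measure_mono
        rintro z ⟨h1, h2⟩
        exact ⟨hST z h1 h2, h2⟩
    _ = ∫⁻ z, (T ∩ {x | ∀ i, 0 < x i}).indicator (fun x : Fin d → ℝ =>
      ENNReal.ofReal ((∏ i, x i ^ (2 * α i + 1)) * Real.exp (-∑ i, x i ^ 2))) z := by
        rw [withDensity_apply _ (hT.inter hO), lintegral_indicator (hT.inter hO)]
    _ ≤ ∫⁻ z, ENNReal.ofReal (Real.exp e) * ((∏ i, wt (2 * α i + 1) (z i)) * T.indicator 1 z) := by
        apply lintegral_mono
        intro z
        by_cases hz : z ∈ T ∩ {x | ∀ i, 0 < x i}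
        · simp only [Set.indicator_of_mem hz, Set.indicator_of_mem hz.1, Pi.one_apply, mul_one]
          rw [mul_comm, ENNReal.ofReal_mul (Real.exp_pos _).le, ENNReal.ofReal_prod_of_nonneg
            (fun i _ => Real.rpow_nonneg (hz.2 i).le _)]
          gcongr with i hi
          · exact he z hz.1
          · simp [wt, Set.indicator_of_mem (show z i ∈ Set.Ioi 0 from hz.2 i)]
        · simp only [Set.indicator_of_notMem hz]
          exact zero_le
    _ = _ := by rw [lintegral_const_mul' _ _ ENNReal.ofReal_ne_top]

lemma measurable_sumsq (d : ℕ) : Measurable fun z : Fin d → ℝ => ∑ i, z i ^ 2 :=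
  Finset.measurable_sum _ fun i _ => (measurable_pi_apply i).pow_const 2

lemma meas_box (d : ℕ) (c : Fin d → ℝ) (ρ : ℝ) : MeasurableSet {z : Fin d → ℝ | ∀ i, |z i - c i| ≤ ρ} := by
  have : {z : Fin d → ℝ | ∀ i, |z i - c i| ≤ ρ} = ⋂ i, {z | |z i - c i| ≤ ρ} := by ext; simp
  rw [this]
  refine MeasurableSet.iInter fun i => measurableSet_le ?_ measurable_const
  exact ((measurable_pi_apply i).sub_const _).abs

lemma box_nu (d : ℕ) (α : Fin d → ℝ) (K : ℕ) (hK : ∀ i, OD (2 * α i + 1) K) (L : ℝ) (hL : 1 ≤ L)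
    (c : Fin d → ℝ) (hc : ∀ i, 0 ≤ c i) (r : ℝ) (hr : 0 < r) (e : ℝ) (S : Set (Fin d → ℝ))
    (hS : ∀ z ∈ S, (∀ i, 0 < z i) → (∀ i, |z i - c i| ≤ L * r) ∧ -∑ i, z i ^ 2 ≤ e) :
    nu d α S ≤ ENNReal.ofReal (Real.exp e * ((K * L ^ K) ^ d * ∏ i, (r * (c i + r) ^ (2 * α i + 1)))) := by
  have hm : ∀ i, MeasurableSet {t : ℝ | 0 < t ∧ |t - c i| ≤ L * r} := by intro i; measurability
  have hT : MeasurableSet ({z : Fin d → ℝ | ∀ i, |z i - c i| ≤ L * r} ∩ {z | -∑ i, z i ^ 2 ≤ e}) :=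
    (meas_box d c _).inter (measurableSet_le (measurable_sumsq d).neg measurable_const)
  refine (nu_le d α S _ hT e (fun z hz hz0 => hS z hz hz0) (fun z hz => hz.2)).trans ?_
  rw [ENNReal.ofReal_mul (Real.exp_pos _).le]
  gcongr
  calc _ ≤ ∫⁻ z : Fin d → ℝ, ∏ i, ({t : ℝ | 0 < t ∧ |t - c i| ≤ L * r}.indicator
        (fun t => ENNReal.ofReal (t ^ (2 * α i + 1))) (z i)) := by
        apply lintegral_mono
        intro z
        by_cases hz : z ∈ ({z : Fin d → ℝ | ∀ i, |z i - c i| ≤ L * r} ∩ {z | -∑ i, z i ^ 2 ≤ e})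
        · simp only [Set.indicator_of_mem hz, Pi.one_apply, mul_one]
          gcongr with i hi
          by_cases h0 : 0 < z i
          · rw [Set.indicator_of_mem (show z i ∈ {t : ℝ | 0 < t ∧ |t - c i| ≤ L * r} from ⟨h0, hz.1 i⟩)]
            simp [wt, Set.indicator_of_mem (show z i ∈ Set.Ioi 0 from h0)]
          · simp [wt, h0]
        · simp only [Set.indicator_of_notMem hz, mul_zero]
          exact zero_le
    _ ≤ ∏ i, ∫⁻ t, ({t : ℝ | 0 < t ∧ |t - c i| ≤ L * r}.indicator
        (fun t => ENNReal.ofReal (t ^ (2 * α i + 1))) t) := 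
        prod_le d (fun i => {t : ℝ | 0 < t ∧ |t - c i| ≤ L * r}.indicator
        (fun t => ENNReal.ofReal (t ^ (2 * α i + 1)))) (fun i => Measurable.indicator (by fun_prop) (hm i))
    _ ≤ ∏ i, ENNReal.ofReal (K * L ^ K * (r * (c i + r) ^ (2 * α i + 1))) := by
        gcongr with i hi
        exact hK i L (c i) r hL (hc i) hr
    _ = ENNReal.ofReal (∏ i, (K * L ^ K * (r * (c i + r) ^ (2 * α i + 1)))) := by
        rw [ENNReal.ofReal_prod_of_nonneg]
        intro i _
        have := hc i
        positivity
    _ = _ := by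
        rw [Finset.prod_mul_distrib]; simp

lemma slice_nu (n : ℕ) (α : Fin (n+1) → ℝ) (K : ℕ) (hK : ∀ i, OD (2 * α i + 1) K) (L : ℝ) (hL : 1 ≤ L)
    (c : Fin (n+1) → ℝ) (hc : ∀ i, 0 ≤ c i) (r : ℝ) (hr : 0 < r) (R : ℝ) (i0 : Fin (n+1)) (X : ℝ) (hX : 0 < X)
    (S : Set (Fin (n+1) → ℝ))
    (hS : ∀ z ∈ S, (∀ i, 0 < z i) → (∀ i, |z i - c i| ≤ L * r) ∧ R ≤ ∑ i, z i ^ 2 ∧ ∑ i, z i ^ 2 ≤ R + 1 ∧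
      X / 2 ≤ z i0 ∧ z i0 ≤ 2 * X) :
    nu (n+1) α S ≤ ENNReal.ofReal (Real.exp (-R) * ((2 ^ |2 * α i0 + 1| * X ^ (2 * α i0 + 1) * (1 / X)) *
      ((K * L ^ K) ^ n * ∏ j, (r * (c (i0.succAbove j) + r) ^ (2 * α (i0.succAbove j) + 1))))) := by
  set T : Set (Fin (n+1) → ℝ) := ({z : Fin (n+1) → ℝ | ∀ i, |z i - c i| ≤ L * r} ∩ {z | R ≤ ∑ i, z i ^ 2})
    ∩ ({z | ∑ i, z i ^ 2 ≤ R + 1} ∩ ({z | X / 2 ≤ z i0} ∩ {z | z i0 ≤ 2 * X})) with hTdef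
  have hT : MeasurableSet T := by
    refine MeasurableSet.inter ((meas_box _ c _).inter (measurableSet_le measurable_const (measurable_sumsq _))) ?_
    refine MeasurableSet.inter (measurableSet_le (measurable_sumsq _) measurable_const) ?_
    exact (measurableSet_le measurable_const (measurable_pi_apply i0)).inter
      (measurableSet_le (measurable_pi_apply i0) measurable_const)
  refine (nu_le _ α S T hT (-R) ?_ ?_).trans ?_
  · intro z hz hz0
    obtain ⟨a, b, c, d, e⟩ := hS z hz hz0
    exact ⟨⟨a, b⟩, c, d, e⟩
  · rintro z ⟨⟨-, h⟩, -⟩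
    exact neg_le_neg h
  rw [ENNReal.ofReal_mul (Real.exp_pos _).le]
  gcongr
  have hm : ∀ i, MeasurableSet {t : ℝ | 0 < t ∧ |t - c i| ≤ L * r} := by intro i; measurability
  set g : Fin (n+1) → ℝ → ENNReal := fun i => {t : ℝ | 0 < t ∧ |t - c i| ≤ L * r}.indicator
        (fun t => ENNReal.ofReal (t ^ (2 * α i + 1))) with hg
  have hgm : ∀ i, Measurable (g i) := fun i => Measurable.indicator (by fun_prop) (hm i)
  calc _ ≤ ∫⁻ z : Fin (n+1) → ℝ, (∏ i, g i (z i)) * T.indicator 1 z := by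
        apply lintegral_mono
        intro z
        by_cases hz : z ∈ T
        · simp only [Set.indicator_of_mem hz, Pi.one_apply, mul_one]
          gcongr with i hi
          by_cases h0 : 0 < z i
          · rw [hg]
            simp only
            rw [Set.indicator_of_mem (show z i ∈ {t : ℝ | 0 < t ∧ |t - c i| ≤ L * r} from ⟨h0, hz.1.1 i⟩)]
            simp [wt, Set.indicator_of_mem (show z i ∈ Set.Ioi 0 from h0)]
          · simp [wt, h0]
        · simp only [Set.indicator_of_notMem hz, mul_zero]
          exact le_rfl
    _ ≤ ENNReal.ofReal (2 ^ |2 * α i0 + 1| * X ^ (2 * α i0 + 1) * (1 / X)) *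
        ∫⁻ w : Fin n → ℝ, ∏ j, g (i0.succAbove j) (w j) := by
        apply slice_le n i0 g hgm T hT
        intro w
        have hins : Measurable fun t : ℝ => (i0.insertNth t w : Fin (n+1) → ℝ) := by
          rw [measurable_pi_iff]
          intro i
          refine Fin.succAboveCases i0 ?_ (fun j => ?_) i
          · simp only [Fin.insertNth_apply_same]; exact measurable_id
          · simp
        refine le_trans ?_ (one_slice (2 * α i0 + 1) X (R - ∑ j, w j ^ 2) hX
          ((fun t : ℝ => (i0.insertNth t w : Fin (n+1) → ℝ)) ⁻¹' T) (hins hT) ?_)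
        · apply lintegral_mono
          intro t
          by_cases ht : (i0.insertNth t w : Fin (n+1) → ℝ) ∈ T
          · simp only [Set.indicator_of_mem ht, Pi.one_apply, mul_one]
            rw [Set.indicator_of_mem (by exact ht)]
            exact Set.indicator_le_self _ _ t
          · simp only [Set.indicator_of_notMem ht, mul_zero]
            exact zero_le
        · rintro t ⟨⟨-, h2⟩, h3, h4, h5⟩
          simp only [Set.mem_ofPred_eq, Fin.sum_univ_succAbove _ i0, Fin.insertNth_apply_same,
            Fin.insertNth_apply_succAbove] at h2 h3 h4 h5
          refine ⟨h4, h5, ?_, ?_⟩ <;> linarith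
    _ ≤ ENNReal.ofReal (2 ^ |2 * α i0 + 1| * X ^ (2 * α i0 + 1) * (1 / X)) *
        ∏ j, ∫⁻ t, g (i0.succAbove j) t := by
        gcongr
        exact prod_le n (fun j => g (i0.succAbove j)) fun j => hgm _
    _ ≤ ENNReal.ofReal (2 ^ |2 * α i0 + 1| * X ^ (2 * α i0 + 1) * (1 / X)) *
        ∏ j, ENNReal.ofReal (K * L ^ K * (r * (c (i0.succAbove j) + r) ^ (2 * α (i0.succAbove j) + 1))) := by
        gcongr with i hi
        exact hK _ L (c _) r hL (hc _) hr
    _ = _ := by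
        rw [← ENNReal.ofReal_prod_of_nonneg, ← ENNReal.ofReal_mul (by positivity), Finset.prod_mul_distrib]
        · simp
        · intro j _
          have := hc (i0.succAbove j)
          positivity

/-- the enlarged regions -/
def BB (d : ℕ) (A s : ℝ) (x : Fin d → ℝ) : Set (Fin d → ℝ) :=
  {y | ∀ i, |(1 + s) * x i - (1 - s) * y i| ≤ A * √s}

/-- volume factor -/
noncomputable def Vv (d : ℕ) (α : Fin d → ℝ) (s : ℝ) (x : Fin d → ℝ) : ℝ :=
  ∏ i, (√s * (x i + √s) ^ (2 * α i + 1))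

lemma geo_L (A s s' x y z : ℝ) (hA : 1 ≤ A) (hs : 0 < s) (hs2 : s ≤ 1/2) (hs' : 0 < s') (hss : s' ≤ 2 * s)
    (hx : 0 ≤ x) (hsx : √s * x ≤ 1) (_hs'2 : s' ≤ 1/2)
    (h1 : |(1 + s) * x - (1 - s) * y| ≤ A * √s) (h2 : |(1 + s') * z - (1 - s') * y| ≤ A * √s') :
    |z - x| ≤ 10 * A * √s := by
  have hq : 0 < √s := Real.sqrt_pos.2 hs
  have hqq : √s * √s = s := Real.mul_self_sqrt hs.le
  have hq' : √s' ≤ 2 * √s := by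
    rw [Real.sqrt_le_left (by positivity)]
    nlinarith
  have h3 : |(1 + s') * z - (1 - s') * y| ≤ 2 * (A * √s) := h2.trans (by nlinarith)
  have hAq : √s ≤ A * √s := by nlinarith
  have e : (1 - s) * (1 + s') * (z - x) = (1 - s) * ((1 + s') * z - (1 - s') * y) -
      (1 - s') * ((1 + s) * x - (1 - s) * y) + 2 * (s - s') * x := by ring
  have hx2 : |2 * (s - s') * x| ≤ 2 * √s := by
    rw [abs_mul, abs_of_nonneg hx, abs_mul]
    have : |s - s'| ≤ s := by rw [abs_le]; constructor <;> linarith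
    calc |2| * |s - s'| * x ≤ 2 * s * x := by gcongr; simp
      _ = 2 * √s * (√s * x) := by nlinarith
      _ ≤ 2 * √s * 1 := by gcongr
      _ = _ := by ring
  have hb : |(1 - s) * (1 + s') * (z - x)| ≤ 5 * (A * √s) := by
    rw [e]
    refine (abs_add_le _ _).trans ?_
    refine (add_le_add (abs_sub _ _) hx2).trans ?_
    rw [abs_mul, abs_mul, abs_of_nonneg (by linarith : 0 ≤ 1 - s), abs_of_nonneg (by linarith : 0 ≤ 1 - s')]
    nlinarith [abs_nonneg ((1 + s') * z - (1 - s') * y), abs_nonneg ((1 + s) * x - (1 - s) * y)]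
  rw [abs_mul, abs_of_nonneg (by nlinarith : 0 ≤ (1 - s) * (1 + s'))] at hb
  have : 1 / 2 ≤ (1 - s) * (1 + s') := by nlinarith
  nlinarith [abs_nonneg (z - x)]

lemma geo_m (A s s' x y z : ℝ) (hA : 1 ≤ A) (hs : 0 < s) (hs1 : s < 1) (hs' : 0 < s') (hs'1 : s' < 1)
    (hss : s' ≤ 4 * s)
    (h1 : |(1 + s) * x - (1 - s) * y| ≤ A * √s) (h2 : |(1 + s') * z - (1 - s') * y| ≤ A * √s') :
    |z - ((1 - s') * (1 + s) / ((1 - s) * (1 + s'))) * x| ≤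
      A * √s * (2 + (1 - s') * (1 + s) / ((1 - s) * (1 + s'))) := by
  have hq : 0 < √s := Real.sqrt_pos.2 hs
  have hqq : √s * √s = s := Real.mul_self_sqrt hs.le
  have hq' : √s' ≤ 2 * √s := by
    rw [Real.sqrt_le_left (by positivity)]
    nlinarith
  have h3 : |(1 + s') * z - (1 - s') * y| ≤ 2 * (A * √s) := h2.trans (by nlinarith)
  have p1 : 0 < 1 - s := by linarith
  have p2 : 0 < 1 - s' := by linarith
  set k := (1 - s') / ((1 - s) * (1 + s')) with hk
  have hk0 : 0 < k := by positivity
  have hm : (1 - s') * (1 + s) / ((1 - s) * (1 + s')) = k * (1 + s) := by rw [hk]; ring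
  rw [hm]
  have e : z - k * (1 + s) * x = ((1 + s') * z - (1 - s') * y) / (1 + s') -
      k * ((1 + s) * x - (1 - s) * y) := by rw [hk]; field_simp; ring
  rw [e]
  refine (abs_sub _ _).trans ?_
  rw [abs_div, abs_mul, abs_of_pos hk0, abs_of_pos (by linarith : 0 < 1 + s')]
  have t1 : |(1 + s') * z - (1 - s') * y| / (1 + s') ≤ 2 * (A * √s) :=
    (div_le_self (abs_nonneg _) (by linarith)).trans h3
  have t2 : k * |(1 + s) * x - (1 - s) * y| ≤ k * (1 + s) * (A * √s) := by
    calc _ ≤ k * (A * √s) := by gcongr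
      _ ≤ _ := by
        have : 0 ≤ k * s * (A * √s) := by positivity
        nlinarith
  linarith

lemma coord_le {d : ℕ} (x : Fin d → ℝ) (i : Fin d) : x i ≤ √(∑ i, x i ^ 2) := by
  apply Real.le_sqrt_of_sq_le
  exact Finset.single_le_sum (f := fun i => x i ^ 2) (fun i _ => sq_nonneg _) (Finset.mem_univ i)

lemma sum_le_nrm {d : ℕ} (x : Fin d → ℝ) : ∑ i, x i ≤ d * √(∑ i, x i ^ 2) := by
  calc ∑ i, x i ≤ ∑ i : Fin d, √(∑ i, x i ^ 2) := Finset.sum_le_sum fun i _ => coord_le x i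
    _ = _ := by simp

lemma nrm_diff {d : ℕ} (x z : Fin d → ℝ) (hx : ∀ i, 0 < x i) (hz : ∀ i, 0 < z i) (m η : ℝ) (hm : 0 < m)
    (hη : 0 ≤ η) (h : ∀ i, |z i - m * x i| ≤ η) (hZ : 0 < √(∑ i, z i ^ 2)) :
    |√(∑ i, z i ^ 2) - m * √(∑ i, x i ^ 2)| ≤ d * η := by
  set Z := √(∑ i, z i ^ 2) with hZd
  set ρ := √(∑ i, x i ^ 2) with hρd
  have hρ : 0 ≤ ρ := Real.sqrt_nonneg _
  have hZ2 : Z ^ 2 = ∑ i, z i ^ 2 := Real.sq_sqrt (Finset.sum_nonneg fun i _ => sq_nonneg _)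
  have hρ2 : ρ ^ 2 = ∑ i, x i ^ 2 := Real.sq_sqrt (Finset.sum_nonneg fun i _ => sq_nonneg _)
  have e : (Z - m * ρ) * (Z + m * ρ) = ∑ i, (z i - m * x i) * (z i + m * x i) := by
    calc (Z - m * ρ) * (Z + m * ρ) = Z ^ 2 - m ^ 2 * ρ ^ 2 := by ring
      _ = _ := by
        rw [hZ2, hρ2, Finset.mul_sum, ← Finset.sum_sub_distrib]
        exact Finset.sum_congr rfl fun i _ => by ring
  have hpos : 0 < Z + m * ρ := by positivity
  have h2 : |Z - m * ρ| * (Z + m * ρ) ≤ d * η * (Z + m * ρ) := by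
    rw [← abs_of_pos hpos, ← abs_mul, abs_of_pos hpos, e]
    calc _ ≤ ∑ i, |(z i - m * x i) * (z i + m * x i)| := Finset.abs_sum_le_sum_abs _ _
      _ ≤ ∑ i, η * (z i + m * x i) := by
        apply Finset.sum_le_sum
        intro i _
        have := hx i
        have := hz i
        have hp : 0 < z i + m * x i := by positivity
        rw [abs_mul, abs_of_pos hp]
        gcongr
        exact h i
      _ = η * (∑ i, z i + m * ∑ i, x i) := by
        rw [← Finset.mul_sum, Finset.sum_add_distrib, Finset.mul_sum]
      _ ≤ η * (d * Z + m * (d * ρ)) := by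
        gcongr
        · exact sum_le_nrm z
        · exact sum_le_nrm x
      _ = _ := by ring
  exact le_of_mul_le_mul_right h2 hpos

set_option maxHeartbeats 400000 in
lemma geo_G {d : ℕ} (hd : 1 ≤ d) (A s s' u n : ℝ) (x y z : Fin d → ℝ) (hx : ∀ i, 0 < x i) (hz : ∀ i, 0 < z i)
    (hA : 1 ≤ A) (hs : 0 < s) (hs1 : s < 1) (hs' : 0 < s') (hs'1 : s' < 1) (hu : 1 ≤ u) (hn : 0 ≤ n)
    (hxu : u ≤ s * ∑ i, x i ^ 2) (hzu : u ≤ s' * ∑ i, z i ^ 2) (hzu2 : s' * ∑ i, z i ^ 2 < 2 * u)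
    (h1 : y ∈ BB d A s x) (h2 : y ∈ BB d A s' z)
    (hn1 : ∑ i, x i ^ 2 - 1 + n ≤ ∑ i, z i ^ 2) (hn2 : ∑ i, z i ^ 2 ≤ ∑ i, x i ^ 2 + n) :
    (26 * d ^ 2 * A * √s ≤ √(∑ i, x i ^ 2) →
      ∀ i, |z i - √(∑ i, x i ^ 2 + n) / √(∑ i, x i ^ 2) * x i| ≤
        13 * d * A * (√(∑ i, x i ^ 2 + n) / √(∑ i, x i ^ 2) * √s)) ∧
    ∀ i, |z i - √(∑ i, x i ^ 2 + n) / √(∑ i, x i ^ 2) * x i| ≤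
        26 * d ^ 2 * A * (√(∑ i, x i ^ 2 + n) / √(∑ i, x i ^ 2) * √s) := by
  have hdR : (1:ℝ) ≤ d := by exact_mod_cast hd
  have hxs : 0 ≤ ∑ i, x i ^ 2 := Finset.sum_nonneg fun i _ => sq_nonneg _
  have hzs : 0 ≤ ∑ i, z i ^ 2 := Finset.sum_nonneg fun i _ => sq_nonneg _
  have hxc : ∀ i, x i ≤ √(∑ i, x i ^ 2) := coord_le x
  have hzc : ∀ i, z i ≤ √(∑ i, z i ^ 2) := coord_le z
  have hnd := nrm_diff x z hx hz
  set Z := √(∑ i, z i ^ 2) with hZd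
  set ρ := √(∑ i, x i ^ 2) with hρd
  set W := √(∑ i, x i ^ 2 + n) with hWd
  have hZ2 : Z ^ 2 = ∑ i, z i ^ 2 := Real.sq_sqrt hzs
  have hρ2 : ρ ^ 2 = ∑ i, x i ^ 2 := Real.sq_sqrt hxs
  have hW2 : W ^ 2 = ∑ i, x i ^ 2 + n := Real.sq_sqrt (by linarith)
  rw [← hρ2] at hW2 hn1 hn2 hxu
  rw [← hZ2] at hn1 hn2 hzu hzu2
  have hZ0 : 0 ≤ Z := Real.sqrt_nonneg _
  have hρ0 : 0 ≤ ρ := Real.sqrt_nonneg _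
  have hW0 : 0 ≤ W := Real.sqrt_nonneg _
  have aux : ∀ a b : ℝ, 0 < a → a < 1 → 0 ≤ b → 1 ≤ a * b ^ 2 → 1 < b := by
    intro a b h1 h2 h3 h4
    by_contra hb
    push Not at hb
    have : b ^ 2 ≤ 1 := by nlinarith
    nlinarith
  have hρ1 : 1 < ρ := aux s ρ hs hs1 hρ0 (by linarith)
  have hZ1 : 1 < Z := aux s' Z hs' hs'1 hZ0 (by linarith)
  have hq : 0 < √s := Real.sqrt_pos.2 hs
  have hqq : √s * √s = s := Real.mul_self_sqrt hs.le
  have hsρ : 1 ≤ √s * ρ := by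
    have : 1 ≤ (√s * ρ) ^ 2 := by rw [mul_pow, pow_two √s, hqq]; linarith
    nlinarith [mul_nonneg hq.le hρ0]
  have hρZ : ρ ^ 2 ≤ 2 * Z ^ 2 := by nlinarith
  have hss : s' ≤ 4 * s := by
    have : s' * Z ^ 2 ≤ 4 * s * Z ^ 2 := by nlinarith
    exact le_of_mul_le_mul_right this (by positivity)
  have hρW : ρ ≤ W := by
    exact (sq_le_sq₀ (by assumption) hW0).1 (by linarith)
  have hZW : Z ≤ W := by
    exact (sq_le_sq₀ (by assumption) hW0).1 (by linarith)
  set m0 := W / ρ with hm0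
  have hρp : 0 < ρ := by linarith
  have hm0ρ : m0 * ρ = W := by rw [hm0]; field_simp
  have hm01 : 1 ≤ m0 := by rw [hm0, le_div_iff₀ hρp]; linarith
  have hWZ : W - Z ≤ √s := by
    have h3 : 0 ≤ W - Z := by linarith
    have h4 : (W - Z) * ρ ≤ 1 := by
      calc (W - Z) * ρ ≤ (W - Z) * (W + Z) := by gcongr; linarith
        _ = W ^ 2 - Z ^ 2 := by ring
        _ ≤ 1 := by linarith
    calc W - Z ≤ (W - Z) * (√s * ρ) := le_mul_of_one_le_right h3 hsρ
      _ = √s * ((W - Z) * ρ) := by ring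
      _ ≤ √s * 1 := by gcongr
      _ = √s := mul_one _
  have main : 26 * d ^ 2 * A * √s ≤ ρ → ∀ i, |z i - m0 * x i| ≤ 13 * d * A * (m0 * √s) := by
    intro hcase i
    have hm' := fun i => geo_m A s s' (x i) (y i) (z i) hA hs hs1 hs' hs'1 hss (h1 i) (h2 i)
    have p1 : 0 < 1 - s := by linarith
    have p2 : 0 < 1 - s' := by linarith
    set m := (1 - s') * (1 + s) / ((1 - s) * (1 + s')) with hm
    have hmp : 0 < m := by positivity
    have hd1 := hnd m (A * √s * (2 + m)) hmp (by positivity) hm' (by linarith)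
    set a := A * √s with ha
    have ha0 : √s ≤ a := le_mul_of_one_le_left hq.le hA
    have hda : 26 * (d * a) ≤ ρ := by
      have : 26 * (d * a) ≤ 26 * d ^ 2 * A * √s := by
        have : 0 ≤ a := by linarith
        have : 26 * d ^ 2 * A * √s = 26 * d * (d * a) := by rw [ha]; ring
        rw [this]
        have h8 : 0 ≤ d * a := by positivity
        have := le_mul_of_one_le_left h8 hdR
        linarith
      linarith
    rw [abs_le] at hd1
    have hm4 : m ≤ 4 * m0 := by
      have : m * ρ ≤ 4 * m0 * ρ := by
        have e1 : m * ρ ≤ Z + d * a * (2 + m) := by linarith [hd1.1]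
        have e2 : 26 * (d * a) * (2 + m) ≤ ρ * (2 + m) :=
          mul_le_mul_of_nonneg_right hda (by linarith)
        have e3 : 0 ≤ d * a * (2 + m) := by positivity
        linarith
      exact le_of_mul_le_mul_right this hρp
    have hmm : |m0 - m| * ρ ≤ d * (a * (2 + m)) + √s := by
      rw [← abs_of_pos hρp, ← abs_mul, sub_mul, hm0ρ, abs_le]
      constructor <;> linarith [hd1.1, hd1.2]
    have hxi := hx i
    have e3 : |z i - m0 * x i| ≤ a * (2 + m) + |m0 - m| * x i := by
      have : z i - m0 * x i = (z i - m * x i) - (m0 - m) * x i := by ring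
      rw [this]
      refine (abs_sub _ _).trans ?_
      rw [abs_mul (m0 - m), abs_of_pos hxi]
      linarith [hm' i]
    have e4 : |m0 - m| * x i ≤ |m0 - m| * ρ := by gcongr; exact hxc i
    have e5 : a * (2 + m) ≤ 6 * (a * m0) := by
      have h9 : a * (2 + m) ≤ a * (6 * m0) := mul_le_mul_of_nonneg_left (by linarith) (by linarith)
      linarith
    have e6 : a * m0 ≤ d * (a * m0) := by
      have : 0 ≤ a * m0 := mul_nonneg (by linarith) (by linarith)
      exact le_mul_of_one_le_left this hdR
    have e7 : √s ≤ a * m0 := ha0.trans (le_mul_of_one_le_right (by linarith) hm01)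
    have e8 : d * (a * (2 + m)) ≤ d * (6 * (a * m0)) := mul_le_mul_of_nonneg_left e5 (by linarith)
    have e9 : 13 * d * A * (m0 * √s) = 13 * (d * (a * m0)) := by rw [ha]; ring
    rw [e9]; linarith
  refine ⟨main, fun i => ?_⟩
  have hms : 0 ≤ m0 * √s := by positivity
  by_cases hcase : 26 * d ^ 2 * A * √s ≤ ρ
  · refine (main hcase i).trans ?_
    gcongr ?_ * A * _
    nlinarith
  · push Not at hcase
    have : |z i - m0 * x i| ≤ W := by
      have := hx i
      have := hz i
      have h5 : m0 * x i ≤ m0 * ρ := by gcongr; exact hxc i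
      have h6 : 0 < m0 * x i := by positivity
      rw [abs_le]; constructor <;> linarith [hzc i]
    refine this.trans ?_
    rw [← hm0ρ]
    calc m0 * ρ ≤ m0 * (26 * d ^ 2 * A * √s) := by gcongr
      _ = _ := by ring

lemma Vv_pos (d : ℕ) (α : Fin d → ℝ) (s : ℝ) (hs : 0 < s) (x : Fin d → ℝ) (hx : ∀ i, 0 < x i) :
    0 < Vv d α s x := by
  apply Finset.prod_pos
  intro i _
  have := hx i
  have := Real.sqrt_pos.2 hs
  positivity

lemma L_bound (d : ℕ) (α : Fin d → ℝ) (K : ℕ) (hK : ∀ i, OD (2 * α i + 1) K) (A : ℝ) (hA : 1 ≤ A)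
    (x : Fin d → ℝ) (hx : ∀ i, 0 < x i) (s : ℝ) (hs : 0 < s) (hsx : s * ∑ i, x i ^ 2 ≤ 1) (S : Set (Fin d → ℝ))
    (hS : ∀ z ∈ S, (∀ i, 0 < z i) → ∀ i, |z i - x i| ≤ 10 * A * √s) :
    nu d α S ≤ ENNReal.ofReal (Real.exp (20 * d * A) * (K * (10 * A) ^ K) ^ d *
      (Real.exp (-∑ i, x i ^ 2) * Vv d α s x)) := by
  have hq : 0 < √s := Real.sqrt_pos.2 hs
  refine (box_nu d α K hK (10 * A) (by linarith) x (fun i => (hx i).le) (√s) hq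
    (-∑ i, x i ^ 2 + 20 * d * A) S ?_).trans ?_
  · intro z hz hz0
    refine ⟨hS z hz hz0, ?_⟩
    have hρ : √s * √(∑ i, x i ^ 2) ≤ 1 := by
      rw [← Real.sqrt_mul hs.le, Real.sqrt_le_left (by norm_num)]
      linarith
    have : ∑ i, x i ^ 2 - ∑ i, z i ^ 2 ≤ 20 * d * A := by
      rw [← Finset.sum_sub_distrib]
      calc ∑ i, (x i ^ 2 - z i ^ 2) ≤ ∑ i, (20 * A * √s) * x i := by
            apply Finset.sum_le_sum
            intro i _
            have h1 := hS z hz hz0 i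
            rw [abs_le] at h1
            have := hx i
            nlinarith [sq_nonneg (z i - x i)]
        _ = (20 * A * √s) * ∑ i, x i := by rw [Finset.mul_sum]
        _ ≤ (20 * A * √s) * (d * √(∑ i, x i ^ 2)) := by gcongr; exact sum_le_nrm x
        _ = 20 * d * A * (√s * √(∑ i, x i ^ 2)) := by ring
        _ ≤ 20 * d * A * 1 := by gcongr
        _ = _ := by ring
    linarith
  · apply ENNReal.ofReal_le_ofReal
    rw [Real.exp_add]
    unfold Vv
    apply le_of_eq; ring

lemma prod_scale (d : ℕ) (α : Fin d → ℝ) (s : ℝ) (hs : 0 < s) (x : Fin d → ℝ) (hx : ∀ i, 0 < x i) (m : ℝ) (hm : 0 < m) :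
    ∏ i, (m * √s * (m * x i + m * √s) ^ (2 * α i + 1)) = m ^ (∑ i, (2 * α i + 2)) * Vv d α s x := by
  rw [Real.rpow_sum_of_pos hm, Vv, ← Finset.prod_mul_distrib]
  apply Finset.prod_congr rfl
  intro i _
  have := hx i
  have hq : 0 < √s := Real.sqrt_pos.2 hs
  rw [← mul_add, Real.mul_rpow hm.le (by positivity), show 2 * α i + 2 = (2 * α i + 1) + 1 by ring,
    Real.rpow_add_one hm.ne' (2 * α i + 1)]
  generalize m ^ (2 * α i + 1) = a
  generalize (x i + √s) ^ (2 * α i + 1) = b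
  ring

lemma exists_max {d : ℕ} (hd : 1 ≤ d) (x : Fin d → ℝ) (hx : ∀ i, 0 < x i) :
    ∃ i0, √(∑ i, x i ^ 2) ≤ d * x i0 := by
  have : Nonempty (Fin d) := ⟨⟨0, hd⟩⟩
  obtain ⟨i0, hi0⟩ := Finite.exists_max x
  refine ⟨i0, ?_⟩
  have h0 := hx i0
  rw [Real.sqrt_le_left (by positivity)]
  have hdR : (1:ℝ) ≤ d := by exact_mod_cast hd
  calc ∑ i, x i ^ 2 ≤ ∑ i : Fin d, x i0 ^ 2 := by
        apply Finset.sum_le_sum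
        intro i _
        have := hx i
        gcongr
        exact hi0 i
    _ = d * x i0 ^ 2 := by simp
    _ ≤ (d * x i0) ^ 2 := by
        rw [mul_pow]
        gcongr
        nlinarith

set_option maxHeartbeats 2000000 in
lemma G_shell (d : ℕ) (hd : 1 ≤ d) (α : Fin d → ℝ) (K : ℕ) (hK1 : 1 ≤ K) (hK : ∀ i, OD (2 * α i + 1) K)
    (A : ℝ) (hA : 1 ≤ A) (x : Fin d → ℝ) (hx : ∀ i, 0 < x i) (s : ℝ) (hs : 0 < s) (hs1 : s < 1)
    (u : ℝ) (hu : 1 ≤ u) (hxu : u ≤ s * ∑ i, x i ^ 2) (n : ℝ) (hn : 0 ≤ n) (S : Set (Fin d → ℝ))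
    (hS : ∀ z ∈ S, (∀ i, 0 < z i) → ∃ s' y, 0 < s' ∧ s' < 1 ∧ u ≤ s' * ∑ i, z i ^ 2 ∧ s' * ∑ i, z i ^ 2 < 2 * u ∧
      y ∈ BB d A s x ∧ y ∈ BB d A s' z ∧ ∑ i, x i ^ 2 - 1 + n ≤ ∑ i, z i ^ 2 ∧ ∑ i, z i ^ 2 ≤ ∑ i, x i ^ 2 + n) :
    nu d α S ≤ ENNReal.ofReal (Real.exp (-(∑ i, x i ^ 2 - 1 + n)) *
      ((d * 4 ^ (∑ i, |2 * α i + 1|)) * (26 * d ^ 2 * A) * (1 / √u) * (K * (26 * d ^ 2 * A) ^ K) ^ d *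
        ((√(∑ i, x i ^ 2 + n) / √(∑ i, x i ^ 2)) ^ (∑ i, (2 * α i + 2)) * Vv d α s x))) := by
  have hdR : (1:ℝ) ≤ d := by exact_mod_cast hd
  have hKR : (1:ℝ) ≤ K := by exact_mod_cast hK1
  have hxs : 0 ≤ ∑ i, x i ^ 2 := Finset.sum_nonneg fun i _ => sq_nonneg _
  have hxs1 : 1 < ∑ i, x i ^ 2 := by
    by_contra hb
    push Not at hb
    nlinarith
  obtain ⟨i0, hi0⟩ := exists_max hd x hx
  have geo : ∀ z ∈ S, (∀ i, 0 < z i) → (26 * d ^ 2 * A * √s ≤ √(∑ i, x i ^ 2) →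
      ∀ i, |z i - √(∑ i, x i ^ 2 + n) / √(∑ i, x i ^ 2) * x i| ≤
        13 * d * A * (√(∑ i, x i ^ 2 + n) / √(∑ i, x i ^ 2) * √s)) ∧
    ∀ i, |z i - √(∑ i, x i ^ 2 + n) / √(∑ i, x i ^ 2) * x i| ≤
        26 * d ^ 2 * A * (√(∑ i, x i ^ 2 + n) / √(∑ i, x i ^ 2) * √s) := fun z hz hz0 => by
    obtain ⟨s', y, a1, a2, a3, a4, a5, a6, a7, a8⟩ := hS z hz hz0
    exact geo_G hd A s s' u n x y z hx hz0 hA hs hs1 a1 a2 hu hn hxu a3 a4 a5 a6 a7 a8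
  have hxu' : √u ≤ √s * √(∑ i, x i ^ 2) := by
    rw [← Real.sqrt_mul hs.le]; exact Real.sqrt_le_sqrt hxu
  set ρ := √(∑ i, x i ^ 2) with hρd
  set W := √(∑ i, x i ^ 2 + n) with hWd
  have hρ : 0 < ρ := Real.sqrt_pos.2 (by linarith)
  have hρW : ρ ≤ W := Real.sqrt_le_sqrt (by linarith)
  set m := W / ρ with hm
  have hm1 : 1 ≤ m := by rw [hm, le_div_iff₀ hρ]; linarith
  have hm0 : 0 < m := by linarith
  have hq : 0 < √s := Real.sqrt_pos.2 hs
  have hq1 : √s ≤ 1 := by rw [Real.sqrt_le_left (by norm_num)]; linarith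
  have hsu : 0 < √u := Real.sqrt_pos.2 (by linarith)
  set L := 26 * (d:ℝ) ^ 2 * A with hL
  have hL1 : 1 ≤ L := by
    have : 1 ≤ (d:ℝ)^2 := by nlinarith
    nlinarith
  have hP : 1 ≤ (4:ℝ) ^ (∑ i, |2 * α i + 1|) :=
    Real.one_le_rpow (by norm_num) (Finset.sum_nonneg fun i _ => abs_nonneg _)
  have hV := Vv_pos d α s hs x hx
  have hKL : 1 ≤ K * L ^ K := one_le_mul_of_one_le_of_one_le hKR (one_le_pow₀ hL1)
  rw [← prod_scale d α s hs x hx m hm0]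
  by_cases hcase : L * √s ≤ ρ
  · obtain ⟨n', rfl⟩ : ∃ n', d = n' + 1 := ⟨d - 1, by omega⟩
    have hx0 := hx i0
    have hkey : 26 * ((n' + 1 : ℕ) : ℝ) * A * √s ≤ x i0 := by
      have : ((n' + 1 : ℕ) : ℝ) * (26 * ((n' + 1 : ℕ) : ℝ) * A * √s) ≤ ((n' + 1 : ℕ) : ℝ) * x i0 := by
        calc _ = L * √s := by rw [hL]; ring
          _ ≤ ρ := hcase
          _ ≤ _ := hi0
      exact le_of_mul_le_mul_left this (by linarith)
    have hsx0 : √s ≤ x i0 := by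
      refine le_trans ?_ hkey
      have : 1 ≤ 26 * ((n' + 1 : ℕ) : ℝ) * A := by nlinarith
      exact le_mul_of_one_le_left hq.le this
    have hX : 0 < m * x i0 := by positivity
    refine (slice_nu n' α K hK L hL1 (fun i => m * x i) (fun i => by have := hx i; positivity) (m * √s) (by positivity)
      (∑ i, x i ^ 2 - 1 + n) i0 (m * x i0) hX S ?_).trans ?_
    · intro z hz hz0
      obtain ⟨g1, g2⟩ := geo z hz hz0
      obtain ⟨s', y, a1, a2, a3, a4, a5, a6, a7, a8⟩ := hS z hz hz0
      have h3 := g1 hcase i0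
      have h4 : 13 * ((n' + 1 : ℕ) : ℝ) * A * (m * √s) ≤ m * x i0 / 2 := by
        calc _ = m * (26 * ((n' + 1 : ℕ) : ℝ) * A * √s) / 2 := by ring
          _ ≤ _ := by gcongr
      have h5 := abs_le.1 (h3.trans h4)
      refine ⟨g2, a7, by linarith, by linarith, by linarith⟩
    · apply ENNReal.ofReal_le_ofReal
      gcongr ?_ * ?_
      rw [Fin.prod_univ_succAbove _ i0]
      set Q := ∏ j, (m * √s * (m * x (i0.succAbove j) + m * √s) ^ (2 * α (i0.succAbove j) + 1)) with hQ
      have hQ0 : 0 ≤ Q := by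
        apply Finset.prod_nonneg
        intro j _
        have := hx (i0.succAbove j)
        positivity
      set Y := (m * x i0 + m * √s) ^ (2 * α i0 + 1) with hY
      have hY0 : 0 ≤ Y := by positivity
      have e1 : (m * x i0) ^ (2 * α i0 + 1) ≤ 2 ^ |2 * α i0 + 1| * Y := by
        apply rpow_comp _ _ _ _ (by norm_num) hX (by positivity)
        · have : 0 < m * √s := by positivity
          linarith
        · have : m * √s ≤ m * x i0 := by gcongr
          linarith
      have e2 : 1 / (m * x i0) ≤ ((n' + 1 : ℕ) : ℝ) * (1 / √u) * (m * √s) := by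
        rw [div_le_iff₀ hX]
        have : 1 ≤ (√s * ρ) / √u := by rw [le_div_iff₀ hsu]; linarith
        calc 1 ≤ (√s * ρ) / √u := this
          _ ≤ (√s * (((n' + 1 : ℕ) : ℝ) * x i0)) / √u := by gcongr
          _ ≤ (m * m) * ((√s * (((n' + 1 : ℕ) : ℝ) * x i0)) / √u) := by
              apply le_mul_of_one_le_left (by positivity)
              nlinarith
          _ = _ := by ring
      have e3 : (2:ℝ) ^ |2 * α i0 + 1| * 2 ^ |2 * α i0 + 1| ≤ 4 ^ (∑ i, |2 * α i + 1|) := by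
        rw [← Real.mul_rpow (by norm_num) (by norm_num)]
        norm_num only
        apply Real.rpow_le_rpow_of_exponent_le (by norm_num)
        exact Finset.single_le_sum (f := fun i => |2 * α i + 1|) (fun i _ => abs_nonneg _) (Finset.mem_univ i0)
      have e4 : (K * L ^ K) ^ n' ≤ (K * L ^ K) ^ (n' + 1) := pow_le_pow_right₀ hKL (by omega)
      calc 2 ^ |2 * α i0 + 1| * (m * x i0) ^ (2 * α i0 + 1) * (1 / (m * x i0)) * ((K * L ^ K) ^ n' * Q)
          ≤ 2 ^ |2 * α i0 + 1| * (2 ^ |2 * α i0 + 1| * Y) * (((n' + 1 : ℕ) : ℝ) * (1 / √u) * (m * √s)) * ((K * L ^ K) ^ (n' + 1) * Q) := by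
            gcongr
        _ = (2 ^ |2 * α i0 + 1| * 2 ^ |2 * α i0 + 1|) * (((n' + 1 : ℕ) : ℝ) * (1 / √u) * (K * L ^ K) ^ (n' + 1) * (m * √s * Y * Q)) := by ring
        _ ≤ 4 ^ (∑ i, |2 * α i + 1|) * (((n' + 1 : ℕ) : ℝ) * (1 / √u) * (K * L ^ K) ^ (n' + 1) * (m * √s * Y * Q)) := by
            gcongr
        _ ≤ L * (4 ^ (∑ i, |2 * α i + 1|) * (((n' + 1 : ℕ) : ℝ) * (1 / √u) * (K * L ^ K) ^ (n' + 1) * (m * √s * Y * Q))) := by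
            apply le_mul_of_one_le_left (by positivity) hL1
        _ = _ := by ring
  · push Not at hcase
    refine (box_nu d α K hK L hL1 (fun i => m * x i) (fun i => by have := hx i; positivity) (m * √s) (by positivity)
      (-(∑ i, x i ^ 2 - 1 + n)) S ?_).trans ?_
    · intro z hz hz0
      obtain ⟨g1, g2⟩ := geo z hz hz0
      obtain ⟨s', y, a1, a2, a3, a4, a5, a6, a7, a8⟩ := hS z hz hz0
      exact ⟨g2, by linarith⟩
    · apply ENNReal.ofReal_le_ofReal
      gcongr ?_ * ?_
      set Q := ∏ i, (m * √s * (m * x i + m * √s) ^ (2 * α i + 1)) with hQ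
      have hQ0 : 0 ≤ Q := by
        apply Finset.prod_nonneg
        intro j _
        have := hx j
        positivity
      gcongr ?_ * _
      have e1 : 1 ≤ L * (1 / √u) := by
        rw [mul_one_div, le_div_iff₀ hsu, one_mul]
        refine hxu'.trans ?_
        calc √s * ρ ≤ 1 * ρ := by gcongr
          _ ≤ L * √s := by linarith
          _ ≤ L * 1 := by gcongr
          _ = L := by ring
      have e2 : 1 ≤ d * (4:ℝ) ^ (∑ i, |2 * α i + 1|) := one_le_mul_of_one_le_of_one_le hdR hP
      calc (K * L ^ K) ^ d = 1 * 1 * (K * L ^ K) ^ d := by ring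
        _ ≤ (d * (4:ℝ) ^ (∑ i, |2 * α i + 1|)) * (L * (1 / √u)) * (K * L ^ K) ^ d := by gcongr
        _ = _ := by ring

lemma G_bound (d : ℕ) (hd : 1 ≤ d) (α : Fin d → ℝ) (hα : ∀ i, -1 < α i) (K : ℕ) (hK1 : 1 ≤ K) (hK : ∀ i, OD (2 * α i + 1) K) :
    ∃ c : ℝ, 1 ≤ c ∧ ∀ (A : ℝ) (_ : 1 ≤ A) (x : Fin d → ℝ) (_ : ∀ i, 0 < x i) (s : ℝ) (_ : 0 < s) (_ : s < 1)
    (u : ℝ) (_ : 1 ≤ u) (_ : u ≤ s * ∑ i, x i ^ 2) (S : Set (Fin d → ℝ))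
    (_ : ∀ z ∈ S, (∀ i, 0 < z i) ∧ ∃ s' y, 0 < s' ∧ s' < 1 ∧ u ≤ s' * ∑ i, z i ^ 2 ∧ s' * ∑ i, z i ^ 2 < 2 * u ∧
      y ∈ BB d A s x ∧ y ∈ BB d A s' z ∧ ∑ i, x i ^ 2 - 1 ≤ ∑ i, z i ^ 2),
    nu d α S ≤ ENNReal.ofReal (c * (26 * d ^ 2 * A) * (K * (26 * d ^ 2 * A) ^ K) ^ d * (1 / √u) * 
      (Real.exp (-∑ i, x i ^ 2) * Vv d α s x)) := by
  set B := ∑ i, (2 * α i + 2) with hB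
  have hB0 : 0 ≤ B := Finset.sum_nonneg fun i _ => by linarith [hα i]
  have hdR : (1:ℝ) ≤ d := by exact_mod_cast hd
  have hP : 1 ≤ (4:ℝ) ^ (∑ i, |2 * α i + 1|) :=
    Real.one_le_rpow (by norm_num) (Finset.sum_nonneg fun i _ => abs_nonneg _)
  have hsum : Summable fun n : ℕ => Real.exp (-(1/2 : ℝ)) ^ n :=
    summable_geometric_of_lt_one (Real.exp_pos _).le (by rw [Real.exp_lt_one_iff]; norm_num)
  set G := ∑' n : ℕ, Real.exp (-(1/2 : ℝ)) ^ n with hG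
  have hG1 : 1 ≤ G := by
    have := hsum.le_tsum 0 (fun n _ => by positivity)
    rw [pow_zero] at this
    exact this
  have hE1 : 1 ≤ Real.exp (B ^ 2 / 2 + 3 / 2) := Real.one_le_exp (by positivity)
  refine ⟨Real.exp (B ^ 2 / 2 + 3 / 2) * G * (d * 4 ^ (∑ i, |2 * α i + 1|)), ?_, ?_⟩
  · exact one_le_mul_of_one_le_of_one_le (one_le_mul_of_one_le_of_one_le hE1 hG1)
      (one_le_mul_of_one_le_of_one_le hdR hP)
  intro A hA x hx s hs hs1 u hu hxu S hS
  have hxs1 : 1 < ∑ i, x i ^ 2 := by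
    have hxs : 0 ≤ ∑ i, x i ^ 2 := Finset.sum_nonneg fun i _ => sq_nonneg _
    by_contra hb
    push Not at hb
    nlinarith
  have hV := Vv_pos d α s hs x hx
  set M := (d * (4:ℝ) ^ (∑ i, |2 * α i + 1|)) * (26 * d ^ 2 * A) * (1 / √u) * (K * (26 * d ^ 2 * A) ^ K) ^ d with hM
  have hM0 : 0 ≤ M := by positivity
  set T : ℕ → Set (Fin d → ℝ) := fun n => {z ∈ S | ∑ i, x i ^ 2 - 1 + n ≤ ∑ i, z i ^ 2 ∧ ∑ i, z i ^ 2 ≤ ∑ i, x i ^ 2 + n} with hT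
  have hcov : S ⊆ ⋃ n, T n := by
    intro z hz
    obtain ⟨-, s', y, a1, a2, a3, a4, a5, a6, a7⟩ := hS z hz
    rw [Set.mem_iUnion]
    refine ⟨⌊∑ i, z i ^ 2 - (∑ i, x i ^ 2 - 1)⌋₊, hz, ?_, ?_⟩
    · have := Nat.floor_le (show 0 ≤ ∑ i, z i ^ 2 - (∑ i, x i ^ 2 - 1) by linarith)
      linarith
    · have := Nat.lt_floor_add_one (∑ i, z i ^ 2 - (∑ i, x i ^ 2 - 1))
      linarith
  have hTn : ∀ n : ℕ, nu d α (T n) ≤ ENNReal.ofReal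
      (M * Real.exp (B ^ 2 / 2 + 3 / 2) * (Real.exp (-∑ i, x i ^ 2) * Vv d α s x) * Real.exp (-(1/2 : ℝ)) ^ n) := by
    intro n
    refine (G_shell d hd α K hK1 hK A hA x hx s hs hs1 u hu hxu n (by positivity) (T n) ?_).trans ?_
    · rintro z ⟨hz, h1, h2⟩ -
      obtain ⟨-, s', y, a1, a2, a3, a4, a5, a6, a7⟩ := hS z hz
      exact ⟨s', y, a1, a2, a3, a4, a5, a6, h1, h2⟩
    · apply ENNReal.ofReal_le_ofReal
      rw [← hM, ← hB]
      have hρ : 0 < √(∑ i, x i ^ 2) := Real.sqrt_pos.2 (by linarith)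
      set m := √(∑ i, x i ^ 2 + n) / √(∑ i, x i ^ 2) with hm
      have hm0 : 0 < m := div_pos (Real.sqrt_pos.2 (by positivity)) hρ
      have hm2 : m ^ 2 ≤ 1 + n := by
        rw [hm, div_pow, Real.sq_sqrt (by positivity), Real.sq_sqrt (by linarith), div_le_iff₀ (by linarith)]
        nlinarith [(Nat.cast_nonneg n : (0:ℝ) ≤ n)]
      have hmB : m ^ B ≤ Real.exp (B ^ 2 / 2 + 1 / 2 + n / 2) := by
        calc m ^ B ≤ (Real.exp m) ^ B := by
              gcongr
              linarith [Real.add_one_le_exp m]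
          _ = Real.exp (m * B) := (Real.exp_mul _ _).symm
          _ ≤ _ := by
              rw [Real.exp_le_exp]
              nlinarith [sq_nonneg (m - B)]
      have hexp : Real.exp (-(∑ i, x i ^ 2 - 1 + n)) * Real.exp (B ^ 2 / 2 + 1 / 2 + n / 2) =
          Real.exp (B ^ 2 / 2 + 3 / 2) * Real.exp (-∑ i, x i ^ 2) * Real.exp (-(1/2 : ℝ)) ^ n := by
        rw [← Real.exp_nat_mul, ← Real.exp_add, ← Real.exp_add, ← Real.exp_add]
        congr 1; ring
      calc _ ≤ Real.exp (-(∑ i, x i ^ 2 - 1 + n)) * (M * (Real.exp (B ^ 2 / 2 + 1 / 2 + n / 2) * Vv d α s x)) := by gcongr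
        _ = M * (Real.exp (-(∑ i, x i ^ 2 - 1 + n)) * Real.exp (B ^ 2 / 2 + 1 / 2 + n / 2)) * Vv d α s x := by ring
        _ = _ := by rw [hexp]; ring
        _ ≤ _ := le_rfl
  calc nu d α S ≤ nu d α (⋃ n, T n) := measure_mono hcov
    _ ≤ ∑' n, nu d α (T n) := measure_iUnion_le _
    _ ≤ ∑' n : ℕ, ENNReal.ofReal (M * Real.exp (B ^ 2 / 2 + 3 / 2) * (Real.exp (-∑ i, x i ^ 2) * Vv d α s x) * Real.exp (-(1/2 : ℝ)) ^ n) :=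
        ENNReal.tsum_le_tsum hTn
    _ = ENNReal.ofReal (∑' n : ℕ, (M * Real.exp (B ^ 2 / 2 + 3 / 2) * (Real.exp (-∑ i, x i ^ 2) * Vv d α s x) * Real.exp (-(1/2 : ℝ)) ^ n)) := by
        rw [ENNReal.ofReal_tsum_of_nonneg]
        · intro n; positivity
        · exact hsum.mul_left _
    _ = _ := by
        rw [tsum_mul_left, ← hG, hM]
        congr 1; ring

lemma meas_BB (d : ℕ) (A s : ℝ) (x : Fin d → ℝ) : MeasurableSet (BB d A s x) := by
  have : BB d A s x = ⋂ i, {y | |(1 + s) * x i - (1 - s) * y i| ≤ A * √s} := by ext; simp [BB]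
  rw [this]
  refine MeasurableSet.iInter fun i => measurableSet_le ?_ measurable_const
  exact (((measurable_pi_apply i).const_mul _).const_sub _).abs

/-- the bad pairs in a class -/
def II (d : ℕ) (α : Fin d → ℝ) (F : (Fin d → ℝ) → ENNReal) (A t : ℝ) (cls : (Fin d → ℝ) → ℝ → Prop) :
    Set ((Fin d → ℝ) × ℝ) :=
  {p | (∀ i, 0 < p.1 i) ∧ 0 < p.2 ∧ p.2 < 1 ∧ cls p.1 p.2 ∧
    ENNReal.ofReal (t * (Real.exp (-∑ i, p.1 i ^ 2) * Vv d α p.2 p.1)) < ∫⁻ y in BB d A p.2 p.1, F y ∂(nu d α)}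

lemma class_le (d : ℕ) (α : Fin d → ℝ) (F : (Fin d → ℝ) → ENNReal) (hF : ∫⁻ x, F x ∂(nu d α) ≠ ⊤) (A t : ℝ) (ht : 0 < t)
    (cls : (Fin d → ℝ) → ℝ → Prop) (δ : (Fin d → ℝ) × ℝ → ℝ) (τ : ℝ) (hτ : 1 < τ)
    (h0 : ∀ p ∈ II d α F A t cls, 0 ≤ δ p) (hR : ∀ p ∈ II d α F A t cls, δ p ≤ 1) (D : ℝ) (hD : 0 ≤ D)
    (h : ∀ x s, (∀ i, 0 < x i) → 0 < s → s < 1 → cls x s → ∀ S : Set (Fin d → ℝ),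
      (∀ z ∈ S, (∀ i, 0 < z i) ∧ ∃ s' y, 0 < s' ∧ s' < 1 ∧ cls z s' ∧ y ∈ BB d A s' z ∧ y ∈ BB d A s x ∧
        δ (z, s') ≤ τ * δ (x, s)) →
      nu d α S ≤ ENNReal.ofReal (D * (Real.exp (-∑ i, x i ^ 2) * Vv d α s x))) :
    nu d α (Prod.fst '' II d α F A t cls) ≤ ENNReal.ofReal (D / t) * ∫⁻ x, F x ∂(nu d α) := by
  apply cover_le (nu d α) (II d α F A t cls) (fun p => BB d A p.2 p.1) (fun p _ => meas_BB _ _ _ _) δ 1 τ hτ h0 hR F hF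
  · rintro p ⟨-, -, -, -, hp⟩
    exact (lt_of_le_of_lt zero_le hp).ne'
  · rintro ⟨x, s⟩ ⟨h1, h2, h3, h4, hp⟩
    refine (h x s h1 h2 h3 h4 _ ?_).trans ?_
    · rintro z ⟨⟨z', s'⟩, ⟨b1, b2, b3, b4, -⟩, rfl, ⟨y, hy1, hy2⟩, hδ⟩
      exact ⟨b1, s', y, b2, b3, b4, hy1, hy2, hδ⟩
    · calc _ = ENNReal.ofReal (D / t) * ENNReal.ofReal (t * (Real.exp (-∑ i, x i ^ 2) * Vv d α s x)) := by
            rw [← ENNReal.ofReal_mul (by positivity)]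
            congr 1; field_simp
        _ ≤ _ := by gcongr

lemma classL1 (d : ℕ) (α : Fin d → ℝ) (K : ℕ) (hK : ∀ i, OD (2 * α i + 1) K) (F : (Fin d → ℝ) → ENNReal)
    (hF : ∫⁻ x, F x ∂(nu d α) ≠ ⊤) (A t : ℝ) (hA : 1 ≤ A) (ht : 0 < t) :
    nu d α (Prod.fst '' II d α F A t (fun x s => s ≤ 1/2 ∧ s * ∑ i, x i ^ 2 ≤ 1)) ≤
      ENNReal.ofReal (Real.exp (20 * d * A) * (K * (10 * A) ^ K) ^ d / t) * ∫⁻ x, F x ∂(nu d α) := by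
  apply class_le d α F hF A t ht _ (fun p => p.2) 2 (by norm_num) (fun p hp => hp.2.1.le) (fun p hp => hp.2.2.1.le) _ (by positivity)
  rintro x s hx hs hs1 ⟨c1, c2⟩ S hS
  apply L_bound d α K hK A hA x hx s hs c2
  intro z hz hz0 i
  obtain ⟨-, s', y, e1, e2, ⟨e3, e4⟩, e5, e6, e7⟩ := hS z hz
  refine geo_L A s s' (x i) (y i) (z i) hA hs c1 e1 e7 (hx i).le ?_ e3 (e6 i) (e5 i)
  calc √s * x i ≤ √s * √(∑ i, x i ^ 2) := by gcongr; exact coord_le x i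
    _ = √(s * ∑ i, x i ^ 2) := (Real.sqrt_mul hs.le _).symm
    _ ≤ 1 := by rw [Real.sqrt_le_left (by norm_num)]; linarith

lemma classL2 (d : ℕ) (α : Fin d → ℝ) (K : ℕ) (hK : ∀ i, OD (2 * α i + 1) K) (F : (Fin d → ℝ) → ENNReal)
    (hF : ∫⁻ x, F x ∂(nu d α) ≠ ⊤) (A t : ℝ) (hA : 1 ≤ A) (ht : 0 < t) :
    nu d α (Prod.fst '' II d α F A t (fun x s => 1/2 < s ∧ s * ∑ i, x i ^ 2 ≤ 1)) ≤
      ENNReal.ofReal (Real.exp (20 * d * A) * (K * (10 * A) ^ K) ^ d / t) * ∫⁻ x, F x ∂(nu d α) := by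
  apply class_le d α F hF A t ht _ (fun p => p.2) 2 (by norm_num) (fun p hp => hp.2.1.le) (fun p hp => hp.2.2.1.le) _ (by positivity)
  rintro x s hx hs hs1 ⟨c1, c2⟩ S hS
  apply L_bound d α K hK A hA x hx s hs c2
  intro z hz hz0 i
  obtain ⟨-, s', y, e1, e2, ⟨e3, e4⟩, e5, e6, e7⟩ := hS z hz
  have key : ∀ (w : Fin d → ℝ) (r : ℝ), 1/2 < r → r * ∑ i, w i ^ 2 ≤ 1 → w i ≤ 2 := by
    intro w r hr hw
    refine (coord_le w i).trans ?_
    have : 0 ≤ ∑ i, w i ^ 2 := Finset.sum_nonneg fun i _ => sq_nonneg _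
    rw [Real.sqrt_le_left (by norm_num)]
    nlinarith
  have k1 := key x s c1 c2
  have k2 := key z s' e3 e4
  have k3 : 1/2 ≤ √s := Real.le_sqrt_of_sq_le (by linarith)
  have k4 : 10 * 1 * (1/2) ≤ 10 * A * √s := by gcongr
  have := hx i
  have := hz0 i
  rw [abs_le]; constructor <;> linarith

lemma classG (d : ℕ) (hd : 1 ≤ d) (α : Fin d → ℝ) (hα : ∀ i, -1 < α i) (K : ℕ) (hK1 : 1 ≤ K) (hK : ∀ i, OD (2 * α i + 1) K) :
    ∃ c : ℝ, 1 ≤ c ∧ ∀ (F : (Fin d → ℝ) → ENNReal)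
    (_ : ∫⁻ x, F x ∂(nu d α) ≠ ⊤) (A t : ℝ) (_ : 1 ≤ A) (_ : 0 < t) (j : ℕ),
    nu d α (Prod.fst '' II d α F A t (fun x s => 2 ^ j ≤ s * ∑ i, x i ^ 2 ∧ s * ∑ i, x i ^ 2 < 2 * 2 ^ j)) ≤
      ENNReal.ofReal ((c * (26 * d ^ 2 * A) * (K * (26 * d ^ 2 * A) ^ K) ^ d / t) * (1 / √2) ^ j) * ∫⁻ x, F x ∂(nu d α) := by
  obtain ⟨c, hc, H⟩ := G_bound d hd α hα K hK1 hK
  refine ⟨c, hc, ?_⟩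
  intro F hF A t hA ht j
  have hu : √((2:ℝ) ^ j) = √2 ^ j := by
    induction j with
    | zero => simp
    | succ j ih => rw [pow_succ, Real.sqrt_mul (by positivity), ih, pow_succ]
  have : (c * (26 * d ^ 2 * A) * (K * (26 * d ^ 2 * A) ^ K) ^ d / t) * (1 / √2) ^ j =
      (c * (26 * d ^ 2 * A) * (K * (26 * d ^ 2 * A) ^ K) ^ d * (1 / √(2 ^ j))) / t := by
    rw [hu, div_pow, one_pow]; ring
  rw [this]
  apply class_le d α F hF A t ht _ (fun p => Real.exp (-∑ i, p.1 i ^ 2)) (Real.exp 1) (Real.one_lt_exp_iff.2 one_pos)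
    (fun p hp => (Real.exp_pos _).le) ?_ _ (by positivity)
  · rintro x s hx hs hs1 ⟨c1, c2⟩ S hS
    apply H A hA x hx s hs hs1 (2 ^ j) (one_le_pow₀ (by norm_num)) c1
    intro z hz
    obtain ⟨e0, s', y, e1, e2, ⟨e3, e4⟩, e5, e6, e7⟩ := hS z hz
    refine ⟨e0, s', y, e1, e2, e3, e4, e6, e5, ?_⟩
    simp only [← Real.exp_add, Real.exp_le_exp] at e7
    linarith
  · intro p hp
    rw [Real.exp_le_one_iff]
    have : 0 ≤ ∑ i, p.1 i ^ 2 := Finset.sum_nonneg fun i _ => sq_nonneg _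
    linarith

lemma total_le (d : ℕ) (hd : 1 ≤ d) (α : Fin d → ℝ) (hα : ∀ i, -1 < α i) :
    ∃ C0 C1 : ℝ, 1 ≤ C0 ∧ 0 ≤ C1 ∧ ∀ (F : (Fin d → ℝ) → ENNReal)
    (_ : ∫⁻ x, F x ∂(nu d α) ≠ ⊤) (A t : ℝ) (_ : 1 ≤ A) (_ : 0 < t),
    nu d α (Prod.fst '' II d α F A t (fun _ _ => True)) ≤
      ENNReal.ofReal (C0 * Real.exp (C1 * A) / t) * ∫⁻ x, F x ∂(nu d α) := by
  obtain ⟨K, hK1, hK⟩ := exists_OD d (fun i => 2 * α i + 1) (fun i => by linarith [hα i])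
  obtain ⟨c, hc, HG⟩ := classG d hd α hα K hK1 hK
  have hsum : Summable fun n : ℕ => (1 / √2 : ℝ) ^ n := by
    apply summable_geometric_of_lt_one (by positivity)
    rw [div_lt_one (by positivity)]
    exact Real.lt_sqrt_of_sq_lt (by norm_num)
  set G := ∑' n : ℕ, (1 / √2 : ℝ) ^ n with hG
  have hG1 : 0 ≤ G := tsum_nonneg fun n => by positivity
  have hdR : (1:ℝ) ≤ d := by exact_mod_cast hd
  have hKR : (1:ℝ) ≤ K := by exact_mod_cast hK1
  refine ⟨(2 + c * G) * K ^ d, 20 * d + (K * d + 1) * (26 * d ^ 2), ?_, by positivity, ?_⟩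
  · apply one_le_mul_of_one_le_of_one_le _ (one_le_pow₀ hKR)
    have : 0 ≤ c * G := by positivity
    linarith
  intro F hF A t hA ht
  set L := 26 * (d:ℝ) ^ 2 * A with hL
  set DL := Real.exp (20 * d * A) * (K * (10 * A) ^ K) ^ d with hDL
  set DG := c * L * (K * L ^ K) ^ d with hDG
  have hL10 : 10 * A ≤ L := by
    have : 1 ≤ (d:ℝ)^2 := by nlinarith
    nlinarith
  have hL1 : 1 ≤ L := by linarith
  have hc0 : 0 ≤ c := by linarith
  have hA0 : 0 ≤ A := by linarith
  have hDL0 : 0 ≤ DL := by positivity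
  have hDG0 : 0 ≤ DG := by positivity
  have hsub : Prod.fst '' II d α F A t (fun _ _ => True) ⊆
      (Prod.fst '' II d α F A t (fun x s => s ≤ 1/2 ∧ s * ∑ i, x i ^ 2 ≤ 1)) ∪
      (Prod.fst '' II d α F A t (fun x s => 1/2 < s ∧ s * ∑ i, x i ^ 2 ≤ 1)) ∪
      ⋃ j : ℕ, Prod.fst '' II d α F A t (fun x s => 2 ^ j ≤ s * ∑ i, x i ^ 2 ∧ s * ∑ i, x i ^ 2 < 2 * 2 ^ j) := by
    rintro _ ⟨⟨x, s⟩, ⟨b1, b2, b3, -, b5⟩, rfl⟩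
    rcases le_or_gt (s * ∑ i, x i ^ 2) 1 with h | h
    · left
      rcases le_or_gt s (1/2) with h' | h'
      · left; exact ⟨(x, s), ⟨b1, b2, b3, ⟨h', h⟩, b5⟩, rfl⟩
      · right; exact ⟨(x, s), ⟨b1, b2, b3, ⟨h', h⟩, b5⟩, rfl⟩
    · right
      obtain ⟨j, hj1, hj2⟩ := exists_nat_pow_near h.le (show (1:ℝ) < 2 by norm_num)
      rw [Set.mem_iUnion]
      refine ⟨j, (x, s), ⟨b1, b2, b3, ⟨hj1, ?_⟩, b5⟩, rfl⟩
      rw [pow_succ] at hj2; simp only; linarith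
  refine (measure_mono hsub).trans ?_
  refine (measure_union_le _ _).trans ?_
  have hGt : nu d α (⋃ j : ℕ, Prod.fst '' II d α F A t (fun x s => 2 ^ j ≤ s * ∑ i, x i ^ 2 ∧ s * ∑ i, x i ^ 2 < 2 * 2 ^ j)) ≤
      ENNReal.ofReal (DG / t * G) * ∫⁻ x, F x ∂(nu d α) := by
    refine (measure_iUnion_le _).trans ?_
    refine (ENNReal.tsum_le_tsum fun j => HG F hF A t hA ht j).trans ?_
    rw [ENNReal.tsum_mul_right, ← ENNReal.ofReal_tsum_of_nonneg, tsum_mul_left]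
    · intro n; positivity
    · exact hsum.mul_left _
  refine (add_le_add ((measure_union_le _ _).trans (add_le_add (classL1 d α K hK F hF A t hA ht)
    (classL2 d α K hK F hF A t hA ht))) hGt).trans ?_
  rw [← add_mul, ← add_mul, ← ENNReal.ofReal_add (by positivity) (by positivity),
    ← ENNReal.ofReal_add (by positivity) (by positivity)]
  gcongr
  rw [← hDL]
  have e1 : DL / t + DL / t + DG / t * G = (2 * DL + DG * G) / t := by ring
  rw [e1]
  gcongr
  have hLe : L ^ (K * d + 1) ≤ Real.exp ((K * d + 1) * (26 * d ^ 2) * A) := by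
    calc L ^ (K * d + 1) ≤ (Real.exp L) ^ (K * d + 1) := by
          gcongr; linarith [Real.add_one_le_exp L]
      _ = _ := by
          rw [← Real.exp_nat_mul]
          congr 1; push_cast; rw [hL]; ring
  have hE : 1 ≤ Real.exp (20 * d * A) := Real.one_le_exp (by positivity)
  have f1 : DL ≤ K ^ d * (Real.exp (20 * d * A) * L ^ (K * d + 1)) := by
    calc DL ≤ Real.exp (20 * d * A) * (K * L ^ K) ^ d := by rw [hDL]; gcongr
      _ = K ^ d * (Real.exp (20 * d * A) * L ^ (K * d)) := by rw [mul_pow, pow_mul]; ring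
      _ ≤ _ := by
        gcongr
        omega
  have f2 : DG ≤ c * (K ^ d * (Real.exp (20 * d * A) * L ^ (K * d + 1))) := by
    calc DG = c * (K ^ d * (1 * L ^ (K * d + 1))) := by rw [hDG, mul_pow, pow_succ, pow_mul]; ring
      _ ≤ _ := by gcongr
  calc 2 * DL + DG * G ≤ 2 * (K ^ d * (Real.exp (20 * d * A) * L ^ (K * d + 1))) +
        c * (K ^ d * (Real.exp (20 * d * A) * L ^ (K * d + 1))) * G := by gcongr
    _ = (2 + c * G) * K ^ d * (Real.exp (20 * d * A) * L ^ (K * d + 1)) := by ring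
    _ ≤ (2 + c * G) * K ^ d * (Real.exp (20 * d * A) * Real.exp ((K * d + 1) * (26 * d ^ 2) * A)) := by gcongr
    _ = _ := by rw [← Real.exp_add]; congr 2; ring

lemma Kker_eq (d : ℕ) (α : Fin d → ℝ) (s : ℝ) (hs : 0 < s) (x y : Fin d → ℝ) (hx : ∀ i, 0 < x i) :
    Kker d α s x y = (Real.exp (-∑ i, x i ^ 2) * Vv d α s x)⁻¹ *
      Real.exp (-(∑ i, ((1 + s) * x i - (1 - s) * y i) ^ 2) / s / 8) := by
  have hq : 0 < √s := Real.sqrt_pos.2 hs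
  have h1 : s ^ (-(d : ℝ) / 2) * (∏ i, (x i + √s) ^ (-(2 * α i + 1))) = (Vv d α s x)⁻¹ := by
    unfold Vv
    rw [Finset.prod_mul_distrib, mul_inv]
    congr 1
    · rw [Finset.prod_const, Finset.card_univ, Fintype.card_fin, Real.sqrt_eq_rpow, ← Real.rpow_natCast,
        ← Real.rpow_mul hs.le, ← Real.rpow_neg hs.le]
      congr 1; ring
    · rw [← Finset.prod_inv_distrib]
      apply Finset.prod_congr rfl
      intro i _
      have := hx i
      rw [Real.rpow_neg (by positivity)]
  unfold Kker
  rw [h1, mul_inv, ← Real.exp_neg, neg_neg, sub_eq_add_neg, Real.exp_add]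
  have : -((∑ i, ((1 + s) * x i - (1 - s) * y i) ^ 2) / (8 * s)) = -(∑ i, ((1 + s) * x i - (1 - s) * y i) ^ 2) / s / 8 := by
    field_simp
  rw [this]; ring

lemma layer (d : ℕ) (α : Fin d → ℝ) (s : ℝ) (hs : 0 < s) (x y : Fin d → ℝ) (hx : ∀ i, 0 < x i) (f : (Fin d → ℝ) → ℝ)
    (hf : ∀ y, 0 ≤ f y) :
    ENNReal.ofReal (Kker d α s x y * f y) ≤ ∑' k : ℕ, ENNReal.ofReal
      ((Real.exp (-∑ i, x i ^ 2) * Vv d α s x)⁻¹ * Real.exp (-(k:ℝ) ^ 2 / 8)) *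
      (BB d (k + 1) s x).indicator (fun y => ENNReal.ofReal (f y)) y := by
  rw [Kker_eq d α s hs x y hx]
  have hV := Vv_pos d α s hs x hx
  have hq : 0 < √s := Real.sqrt_pos.2 hs
  have hS0 : 0 ≤ ∑ i, ((1 + s) * x i - (1 - s) * y i) ^ 2 := Finset.sum_nonneg fun i _ => sq_nonneg _
  set q := (∑ i, ((1 + s) * x i - (1 - s) * y i) ^ 2) / s with hqd
  have hq0 : 0 ≤ q := by positivity
  set k := ⌊√q⌋₊ with hk
  have hk1 : (k:ℝ) ≤ √q := Nat.floor_le (Real.sqrt_nonneg _)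
  have hk2 : √q ≤ k + 1 := (Nat.lt_floor_add_one _).le
  have hkq : (k:ℝ) ^ 2 ≤ q := by
    rw [← Real.sq_sqrt hq0]; gcongr
  have hmem : y ∈ BB d (k + 1) s x := by
    intro i
    have h1 : ((1 + s) * x i - (1 - s) * y i) ^ 2 ≤ q * s := by
      rw [hqd, div_mul_cancel₀ _ hs.ne']
      exact Finset.single_le_sum (f := fun i => ((1 + s) * x i - (1 - s) * y i) ^ 2) (fun i _ => sq_nonneg _) (Finset.mem_univ i)
    calc |(1 + s) * x i - (1 - s) * y i| ≤ √(q * s) := Real.abs_le_sqrt h1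
      _ = √q * √s := Real.sqrt_mul hq0 _
      _ ≤ _ := by gcongr
  refine le_trans ?_ (ENNReal.le_tsum k)
  rw [Set.indicator_of_mem hmem, ← ENNReal.ofReal_mul (by positivity)]
  apply ENNReal.ofReal_le_ofReal
  have : -(∑ i, ((1 + s) * x i - (1 - s) * y i) ^ 2) / s / 8 = -q / 8 := by rw [hqd]; ring
  rw [this]
  have := hf y
  gcongr

lemma summable_gauss (C : ℝ) : Summable fun k : ℕ => Real.exp (C * (k + 1) - (k:ℝ) ^ 2 / 16) := by
  refine Summable.of_nonneg_of_le (fun k => (Real.exp_pos _).le) (f := fun k : ℕ => Real.exp (C + 4 * (C + 1) ^ 2) * Real.exp (-1) ^ k) ?_ ?_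
  · intro k
    rw [← Real.exp_nat_mul, ← Real.exp_add, Real.exp_le_exp]
    nlinarith [sq_nonneg ((k:ℝ) / 4 - 2 * (C + 1))]
  · apply Summable.mul_left
    exact summable_geometric_of_lt_one (Real.exp_pos _).le (by rw [Real.exp_lt_one_iff]; norm_num)

theorem stmt6 (d : ℕ) (hd : 1 ≤ d) (α : Fin d → ℝ) (hα : ∀ i, -1 < α i) :
    ∃ C : ℝ, 0 < C ∧ ∀ f : (Fin d → ℝ) → ℝ, (∀ x, 0 ≤ f x) →
      Integrable f (nu d α) → ∀ lam : ℝ, 0 < lam →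
      nu d α {x | ENNReal.ofReal lam <
          ⨆ s ∈ Set.Ioo (0 : ℝ) 1, ∫⁻ y, ENNReal.ofReal (Kker d α s x y * f y) ∂(nu d α)} ≤
        ENNReal.ofReal (C / lam * ∫ x, f x ∂(nu d α)) := by
  obtain ⟨C0, C1, hC0, hC1, HT⟩ := total_le d hd α hα
  have hs0 : Summable fun k : ℕ => Real.exp (-(k:ℝ) ^ 2 / 16) := by
    refine (summable_gauss 0).congr fun k => ?_
    congr 1; ring
  have hs1 := summable_gauss C1
  set g := ∑' k : ℕ, Real.exp (-(k:ℝ) ^ 2 / 16) with hg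
  have hg0 : 0 < g := hs0.tsum_pos (fun k => (Real.exp_pos _).le) 0 (Real.exp_pos _)
  set G := ∑' k : ℕ, Real.exp (C1 * (k + 1) - (k:ℝ) ^ 2 / 16) with hG
  have hG0 : 0 < G := hs1.tsum_pos (fun k => (Real.exp_pos _).le) 0 (Real.exp_pos _)
  refine ⟨C0 * g * G, by positivity, ?_⟩
  intro f hf hfi lam hlam
  set F : (Fin d → ℝ) → ENNReal := fun y => ENNReal.ofReal (f y) with hFd
  have hFm : AEMeasurable F (nu d α) := hfi.aemeasurable.ennreal_ofReal
  have hFint : ∫⁻ x, F x ∂(nu d α) = ENNReal.ofReal (∫ x, f x ∂(nu d α)) :=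
    (ofReal_integral_eq_lintegral_ofReal hfi (Filter.Eventually.of_forall hf)).symm
  have hFt : ∫⁻ x, F x ∂(nu d α) ≠ ⊤ := by rw [hFint]; exact ENNReal.ofReal_ne_top
  have hO : MeasurableSet {x : Fin d → ℝ | ∀ i, 0 < x i} := by
    have : {x : Fin d → ℝ | ∀ i, 0 < x i} = ⋂ i, {x | 0 < x i} := by ext; simp
    rw [this]
    exact MeasurableSet.iInter fun i => measurableSet_lt measurable_const (measurable_pi_apply i)
  set t : ℕ → ℝ := fun k => lam / g * Real.exp ((k:ℝ) ^ 2 / 16) with ht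
  have ht0 : ∀ k, 0 < t k := fun k => by positivity
  set E := {x | ENNReal.ofReal lam <
          ⨆ s ∈ Set.Ioo (0 : ℝ) 1, ∫⁻ y, ENNReal.ofReal (Kker d α s x y * f y) ∂(nu d α)} with hE
  have hsub : E ∩ {x | ∀ i, 0 < x i} ⊆ ⋃ k : ℕ, Prod.fst '' II d α F (k + 1) (t k) (fun _ _ => True) := by
    rintro x ⟨hx, hx0⟩
    have hx0 : ∀ i, 0 < x i := hx0
    have hx : ENNReal.ofReal lam <
          ⨆ s ∈ Set.Ioo (0 : ℝ) 1, ∫⁻ y, ENNReal.ofReal (Kker d α s x y * f y) ∂(nu d α) := hx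
    obtain ⟨s, hx⟩ := lt_iSup_iff.1 hx
    obtain ⟨⟨hs, hs1'⟩, hx⟩ := lt_iSup_iff.1 hx
    rw [Set.mem_iUnion]
    by_contra hcon
    push Not at hcon
    have hk : ∀ k : ℕ, ∫⁻ y in BB d (k + 1) s x, F y ∂(nu d α) ≤
        ENNReal.ofReal (t k * (Real.exp (-∑ i, x i ^ 2) * Vv d α s x)) := by
      intro k
      by_contra hlt
      push Not at hlt
      exact hcon k ⟨(x, s), ⟨hx0, hs, hs1', trivial, hlt⟩, rfl⟩
    have hV := Vv_pos d α s hs x hx0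
    apply absurd hx
    push Not
    calc ∫⁻ y, ENNReal.ofReal (Kker d α s x y * f y) ∂(nu d α)
        ≤ ∫⁻ y, ∑' k : ℕ, ENNReal.ofReal
          ((Real.exp (-∑ i, x i ^ 2) * Vv d α s x)⁻¹ * Real.exp (-(k:ℝ) ^ 2 / 8)) *
          (BB d (k + 1) s x).indicator F y ∂(nu d α) := lintegral_mono fun y => layer d α s hs x y hx0 f hf
      _ = ∑' k : ℕ, ENNReal.ofReal
          ((Real.exp (-∑ i, x i ^ 2) * Vv d α s x)⁻¹ * Real.exp (-(k:ℝ) ^ 2 / 8)) *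
          ∫⁻ y in BB d (k + 1) s x, F y ∂(nu d α) := by
          rw [lintegral_tsum (fun k => (hFm.indicator (meas_BB _ _ _ _)).const_mul _)]
          congr 1; ext k
          rw [lintegral_const_mul' _ _ ENNReal.ofReal_ne_top, lintegral_indicator (meas_BB _ _ _ _)]
      _ ≤ ∑' k : ℕ, ENNReal.ofReal (lam / g * Real.exp (-(k:ℝ) ^ 2 / 16)) := by
          apply ENNReal.tsum_le_tsum
          intro k
          refine (mul_le_mul_right (hk k) _).trans ?_
          rw [← ENNReal.ofReal_mul (by positivity)]
          apply ENNReal.ofReal_le_ofReal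
          apply le_of_eq
          have e1 : Real.exp (-(k:ℝ) ^ 2 / 16) = Real.exp (-(k:ℝ) ^ 2 / 8) * Real.exp ((k:ℝ) ^ 2 / 16) := by
            rw [← Real.exp_add]; congr 1; ring
          rw [e1, ht]
          field_simp
      _ = ENNReal.ofReal lam := by
          rw [← ENNReal.ofReal_tsum_of_nonneg (fun k => by positivity) (hs0.mul_left _), tsum_mul_left, ← hg,
            div_mul_cancel₀ _ hg0.ne']
  have hEO : nu d α E = nu d α (E ∩ {x | ∀ i, 0 < x i}) := by
    unfold nu
    rw [Measure.restrict_apply' hO, Measure.restrict_apply' hO, Set.inter_assoc, Set.inter_self]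
  rw [hEO]
  calc _ ≤ nu d α (⋃ k : ℕ, Prod.fst '' II d α F (k + 1) (t k) (fun _ _ => True)) := measure_mono hsub
    _ ≤ ∑' k : ℕ, nu d α (Prod.fst '' II d α F (k + 1) (t k) (fun _ _ => True)) := measure_iUnion_le _
    _ ≤ ∑' k : ℕ, ENNReal.ofReal (C0 * g / lam * Real.exp (C1 * (k + 1) - (k:ℝ) ^ 2 / 16)) * ∫⁻ x, F x ∂(nu d α) := by
        apply ENNReal.tsum_le_tsum
        intro k
        refine (HT F hFt (k + 1) (t k) (by linarith [(Nat.cast_nonneg k : (0:ℝ) ≤ k)]) (ht0 k)).trans ?_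
        gcongr
        apply le_of_eq
        rw [Real.exp_sub, ht]
        field_simp
    _ = ENNReal.ofReal (C0 * g / lam * G) * ∫⁻ x, F x ∂(nu d α) := by
        rw [ENNReal.tsum_mul_right, ← ENNReal.ofReal_tsum_of_nonneg (fun k => by positivity) (hs1.mul_left _), tsum_mul_left]
    _ = _ := by
        rw [hFint, ← ENNReal.ofReal_mul (by positivity)]
        congr 1; ring
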